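/- arXiv:1310.7692 — 3 statements merged into one kernel-verified Lean document; each statement's English description precedes it below -/
import Mathlib

section
/- Let K be a field of characteristic not 2, let n = 2g+2 be even with g ≥ 0, and let f(x,y) = f₀xⁿ + f₁x^{n−1}y + ⋯ + f_nyⁿ be a binary form of degree n over K with f₀ ≠ 0 and with f(x,1) separable of degree n. Then there exists a pair (A,B) of n×n symmetric matrices over K with (−1)^{n(n−1)/2}·det(xA − yB) = f(x,y) (as binary forms in x and y) if and only if f₀ lies in the subgroup K^{×2}·N_{L/K}(L^×) of K^×, i.e., if and only if there exist c ∈ K^× and μ ∈ L^× with f₀ = c²·N_{L/K}(μ). -/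
open Polynomial

noncomputable def binForm {n : ℕ} {R : Type*} [CommRing R] (f : Fin (n+1) → R) :
    MvPolynomial (Fin 2) R :=
  ∑ i : Fin (n+1), MvPolynomial.C (f i) * MvPolynomial.X 0 ^ (n - (i:ℕ)) * MvPolynomial.X 1 ^ (i:ℕ)

noncomputable def pencilDisc {m : Type*} [Fintype m] [DecidableEq m] {R : Type*} [CommRing R]
    (A B : Matrix m m R) : MvPolynomial (Fin 2) R :=
  (-1) ^ (Fintype.card m * (Fintype.card m - 1) / 2) *
    Matrix.det (Matrix.of fun i j =>
      MvPolynomial.X (0 : Fin 2) * MvPolynomial.C (A i j) - MvPolynomial.X (1 : Fin 2) * MvPolynomial.C (B i j))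

noncomputable def fxOne {n : ℕ} {R : Type*} [CommRing R] (f : Fin (n+1) → R) : R[X] :=
  ∑ i : Fin (n+1), C (f i) * X ^ (n - (i:ℕ))

noncomputable abbrev Lf {n : ℕ} {K : Type*} [Field K] (f : Fin (n+1) → K) :=
  AdjoinRoot (C (f 0)⁻¹ * fxOne f)

theorem charpoly_dvd_of_aeval_eq_zero {K : Type*} [Field K] {n : ℕ}
    {T : Matrix (Fin n) (Fin n) K} (hT : T.charpoly.Separable) {p : K[X]}
    (hp : aeval T p = 0) : T.charpoly ∣ p := by
  rcases eq_or_ne p 0 with rfl | hp0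
  · exact dvd_zero _
  let E := AlgebraicClosure K
  let i := algebraMap K E
  rw [← Polynomial.map_dvd_map i i.injective T.charpoly_monic]
  have h0 : T.charpoly.map i ≠ 0 := (T.charpoly_monic.map i).ne_zero
  refine (IsAlgClosed.splits _).dvd_of_roots_le_roots h0
    ((Multiset.le_iff_subset (nodup_roots hT.map)).2 fun a ha => ?_)
  rw [mem_roots h0, ← Matrix.charpoly_map, IsRoot, Matrix.eval_charpoly] at ha
  rw [mem_roots (Polynomial.map_ne_zero hp0)]
  have hs : a ∈ spectrum E (T.map i) := by
    rw [spectrum.mem_iff, Matrix.isUnit_iff_isUnit_det]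
    intro h
    rw [Matrix.algebraMap_eq_diagonal] at h
    simp only [Matrix.scalar_apply] at ha
    exact h.ne_zero ha
  have h1 := spectrum.subset_polynomial_aeval (T.map i) (p.map i) ⟨a, hs, rfl⟩
  have h2 : aeval (T.map i) (p.map i) = 0 := by
    have := congrArg i.mapMatrix hp
    rw [aeval_def, hom_eval₂, map_zero] at this
    rw [aeval_def, eval₂_map, ← this]
    congr 1
    ext x : 1
    ext j k
    simp [Matrix.algebraMap_eq_diagonal, Matrix.diagonal_apply]
    split_ifs <;> simp
  rw [h2] at h1
  by_contra hne
  rw [spectrum.mem_iff, sub_zero] at h1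
  exact h1 ((isUnit_iff_ne_zero.2 hne).map (algebraMap E (Matrix (Fin n) (Fin n) E)))

theorem exists_cyclic_vector {K : Type*} [Field K] {n : ℕ}
    {T : Matrix (Fin n) (Fin n) K} (hT : T.charpoly.Separable) :
    ∃ v : Fin n → K, ∀ p : K[X], (aeval T p).mulVec v = 0 → T.charpoly ∣ p := by
  obtain ⟨x, hx⟩ := Module.exists_ker_toSpanSingleton_eq_annihilator K[X]
    (Module.AEval' (Matrix.toLin' T))
  obtain ⟨v, rfl⟩ := (Module.AEval'.of _).surjective x
  refine ⟨v, fun p hp => charpoly_dvd_of_aeval_eq_zero hT ?_⟩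
  have hlin : ∀ w, aeval (Matrix.toLin' T) p w = (aeval T p).mulVec w := fun w => by
    have := Polynomial.aeval_algHom_apply (Matrix.toLinAlgEquiv' : _ ≃ₐ[K] _).toAlgHom T p
    exact congrArg (fun f => f w) this
  have hmem : p ∈ Module.annihilator K[X] (Module.AEval' (Matrix.toLin' T)) := by
    rw [← hx, LinearMap.mem_ker, LinearMap.toSpanSingleton_apply, ← Module.AEval.of_aeval_smul]
    simp [hlin, hp]
  apply Matrix.toLin'.injective
  refine LinearMap.ext fun w => ?_
  have h := Module.mem_annihilator.1 hmem (Module.AEval'.of _ w)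
  rw [← Module.AEval.of_aeval_smul, LinearEquiv.map_eq_zero_iff] at h
  rw [map_zero, Matrix.toLin'_apply, ← hlin]
  exact h


theorem det_of_hankel {R : Type*} [CommRing R] {n : ℕ} (M : Matrix (Fin n) (Fin n) R)
    (h0 : ∀ i j : Fin n, (i : ℕ) + j + 1 < n → M i j = 0)
    (h1 : ∀ i j : Fin n, (i : ℕ) + j + 1 = n → M i j = 1) :
    M.det = (-1) ^ (n * (n - 1) / 2) := by
  have hs : (Fin.revPerm : Equiv.Perm (Fin n)).sign = (-1) ^ (n * (n - 1) / 2) := by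
    rw [Equiv.Perm.sign_eq_prod_prod_Ioi]
    have : ∀ i : Fin n, ∏ j ∈ Finset.Ioi i,
        (if Fin.revPerm i < Fin.revPerm j then (1 : ℤˣ) else -1) = (-1) ^ (n - 1 - (i : ℕ)) := by
      intro i
      rw [Finset.prod_congr rfl (g := fun _ => (-1 : ℤˣ)), Finset.prod_const, Fin.card_Ioi]
      intro j hj
      rw [Finset.mem_Ioi] at hj
      rw [if_neg]
      simpa using hj.le
    rw [Finset.prod_congr rfl fun i _ => this i, Finset.prod_pow_eq_pow_sum,
      Fin.sum_univ_eq_sum_range (fun i => n - 1 - i) n, Finset.sum_range_reflect (fun i => i),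
      Finset.sum_range_id]
  have hd : (M.submatrix Fin.revPerm id).det = 1 := by
    rw [Matrix.det_of_isUpperTriangular]
    · refine Finset.prod_eq_one fun i _ => h1 _ _ ?_
      simp [Fin.val_rev]
      omega
    · intro i j hij
      refine h0 _ _ ?_
      have : j < i := by simpa using hij
      simp [Fin.val_rev]
      omega
  rw [Matrix.det_permute, hs] at hd
  push_cast at hd
  calc M.det = ((-1) ^ (n * (n - 1) / 2) * (-1) ^ (n * (n - 1) / 2)) * M.det := by
        rw [← mul_pow]; simp
    _ = (-1) ^ (n * (n - 1) / 2) := by rw [mul_assoc, hd, mul_one]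

theorem gram_mul_left {K L : Type*} [Field K] [CommRing L] [Algebra K L] {n : ℕ}
    (b : Module.Basis (Fin n) K L) (ψ : L →ₗ[K] K) (α : L) :
    (Matrix.of fun i j => ψ (α * (b i * b j))) =
      (Matrix.of fun i j => ψ (b i * b j)) * Algebra.leftMulMatrix b α := by
  ext i j
  simp only [Matrix.mul_apply, Matrix.of_apply, Algebra.leftMulMatrix_eq_repr_mul]
  calc ψ (α * (b i * b j)) = ψ (b i * (α * b j)) := by congr 1; ring
    _ = ψ (b i * ∑ k, b.repr (α * b j) k • b k) := by rw [b.sum_repr]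
    _ = _ := by rw [Finset.mul_sum, map_sum]; simp [mul_comm]

theorem det_gram_coord {K L : Type*} [Field K] [CommRing L] [Algebra K L] {n : ℕ}
    (b : Module.Basis (Fin n) K L) {θ : L} (hb : ∀ i, b i = θ ^ (i : ℕ)) {l : Fin n}
    (hl : (l : ℕ) + 1 = n) :
    (Matrix.of fun i j => b.coord l (b i * b j)).det = (-1) ^ (n * (n - 1) / 2) := by
  have key : ∀ i j : Fin n, ∀ h : (i : ℕ) + j < n, b i * b j = b ⟨i + j, h⟩ := fun i j h => by
    rw [hb, hb, hb, pow_add]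
  refine det_of_hankel _ (fun i j h => ?_) fun i j h => ?_
  · rw [Matrix.of_apply, key i j (by omega), b.coord_apply, b.repr_self,
      Finsupp.single_eq_of_ne (fun e => by have := congrArg Fin.val e; simp at this; omega)]
  · have : (⟨i + j, by omega⟩ : Fin n) = l := Fin.ext (by simp; omega)
    rw [Matrix.of_apply, key i j (by omega), b.coord_apply, b.repr_self, this,
      Finsupp.single_eq_same]

theorem exists_eq_mul_of_det_gram_ne_zero {K L : Type*} [Field K] [CommRing L] [Algebra K L] {n : ℕ}
    (b : Module.Basis (Fin n) K L) (ψ φ : L →ₗ[K] K)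
    (h : (Matrix.of fun i j => ψ (b i * b j)).det ≠ 0) : ∃ α, ∀ x, φ x = ψ (α * x) := by
  set G := Matrix.of fun i j => ψ (b i * b j) with hG
  let c := G⁻¹.mulVec fun i => φ (b i)
  have hc : G.mulVec c = fun i => φ (b i) := by
    rw [Matrix.mulVec_mulVec, Matrix.mul_nonsing_inv _ (isUnit_iff_ne_zero.2 h), Matrix.one_mulVec]
  refine ⟨∑ j, c j • b j, fun x => ?_⟩
  suffices φ = ψ ∘ₗ LinearMap.mulLeft K (∑ j, c j • b j) from congrArg (fun f => f x) this
  refine b.ext fun i => ?_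
  rw [← congrFun hc i]
  rw [LinearMap.comp_apply, LinearMap.mulLeft_apply, Finset.sum_mul, map_sum]
  simp [Matrix.mulVec, dotProduct, hG, mul_comm]

theorem isUnit_of_norm_ne_zero {K L : Type*} [Field K] [CommRing L] [Algebra K L]
    [FiniteDimensional K L] {x : L} (hx : Algebra.norm K x ≠ 0) : IsUnit x := by
  obtain ⟨y, hy⟩ := (LinearMap.equivOfDetNeZero (Algebra.lmul K L x) hx).surjective 1
  exact IsUnit.of_mul_eq_one y hy

theorem exists_det_eq_sq_mul_norm {K L : Type*} [Field K] [CommRing L] [Algebra K L] {n : ℕ}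
    (b : Module.Basis (Fin n) K L) {θ : L} (hb : ∀ i, b i = θ ^ (i : ℕ)) (hn : n ≠ 0)
    (ρ : L →ₐ[K] Matrix (Fin n) (Fin n) K) {v : Fin n → K}
    (hv : ∀ x, (ρ x).mulVec v = 0 → x = 0) {A : Matrix (Fin n) (Fin n) K} (hA : A.det ≠ 0)
    (hρ : ∀ x, (ρ x).transpose * A = A * ρ x) :
    ∃ (c : Kˣ) (μ : Lˣ), (-1) ^ (n * (n - 1) / 2) * A.det = (c : K) ^ 2 * Algebra.norm K (μ : L) := by
  have : FiniteDimensional K L := b.finiteDimensional_of_finite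
  let P : Matrix (Fin n) (Fin n) K := Matrix.of fun i j => (ρ (b j)).mulVec v i
  have hP : P.det ≠ 0 := by
    intro h0
    obtain ⟨w, hw, hPw⟩ := Matrix.exists_mulVec_eq_zero_iff.2 h0
    have h1 : (ρ (∑ j, w j • b j)).mulVec v = 0 := by
      rw [← hPw]
      ext i
      simp [P, Matrix.mulVec, dotProduct, Matrix.sum_apply, Finset.sum_mul]
      rw [Finset.sum_comm]
      refine Finset.sum_congr rfl fun j _ => Finset.sum_congr rfl fun k _ => by ring
    exact hw (funext fun j => Fintype.linearIndependent_iff.1 b.linearIndependent w (hv _ h1) j)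
  let φ : L →ₗ[K] K :=
    { toFun := fun x => v ⬝ᵥ (A * ρ x).mulVec v
      map_add' := fun x y => by simp [mul_add, Matrix.add_mulVec]
      map_smul' := fun a x => by simp [Matrix.smul_mulVec] }
  have hgram : P.transpose * A * P = Matrix.of fun i j => φ (b i * b j) := by
    ext i j
    have h1 : P.transpose i = (ρ (b i)).mulVec v := by ext; simp [P]
    have h2 : P.col j = (ρ (b j)).mulVec v := by ext; simp [P]
    calc (P.transpose * A * P) i j = P.transpose i ⬝ᵥ A.mulVec (P.col j) := by
          rw [Matrix.mul_assoc]; rfl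
      _ = v ⬝ᵥ ((ρ (b i)).transpose * A * ρ (b j)).mulVec v := by
          rw [h1, h2, Matrix.mulVec_mulVec, ← Matrix.vecMul_transpose, ← Matrix.dotProduct_mulVec,
            Matrix.mulVec_mulVec, Matrix.mul_assoc]
      _ = _ := by simp [hρ, φ, Matrix.mul_assoc]
  obtain ⟨l, hl⟩ : ∃ l : Fin n, (l : ℕ) + 1 = n := ⟨⟨n - 1, by omega⟩, by simp; omega⟩
  have hs := det_gram_coord b hb hl
  obtain ⟨α, hα⟩ := exists_eq_mul_of_det_gram_ne_zero b (b.coord l) φ (by rw [hs]; simp)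
  have hdet := congrArg Matrix.det hgram
  simp_rw [hα] at hdet
  rw [gram_mul_left, Matrix.det_mul, Matrix.det_mul, Matrix.det_mul, hs,
    ← Algebra.norm_eq_matrix_det, Matrix.det_transpose] at hdet
  have h1 : ((-1 : K) ^ (n * (n - 1) / 2)) * (-1) ^ (n * (n - 1) / 2) = 1 := by
    rw [← mul_pow]; simp
  have hN : Algebra.norm K α ≠ 0 := by
    intro h0
    rw [h0, mul_zero] at hdet
    simp_all
  refine ⟨(Units.mk0 _ hP)⁻¹, (isUnit_of_norm_ne_zero hN).unit, ?_⟩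
  rw [IsUnit.unit_spec, Units.val_inv_eq_inv_val, Units.val_mk0]
  field_simp
  linear_combination (-1 : K) ^ (n * (n - 1) / 2) * hdet + Algebra.norm K α * h1

theorem exists_pencil_of_sq_mul_norm {K L : Type*} [Field K] [CommRing L] [Algebra K L] {n : ℕ}
    (b : Module.Basis (Fin n) K L) {θ : L} (hb : ∀ i, b i = θ ^ (i : ℕ)) (hn : n ≠ 0)
    (c : K) (μ : L) :
    ∃ A B : Matrix (Fin n) (Fin n) K, A.IsSymm ∧ B.IsSymm ∧
      C ((-1) ^ (n * (n - 1) / 2)) * ((X : K[X]) • A.map C - B.map C).det =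
        C (c ^ 2 * Algebra.norm K μ) * (Algebra.leftMulMatrix b θ).charpoly := by
  obtain ⟨l, hl⟩ : ∃ l : Fin n, (l : ℕ) + 1 = n := ⟨⟨n - 1, by omega⟩, by simp; omega⟩
  let P : Matrix (Fin n) (Fin n) K := Matrix.diagonal (Function.update 1 l c)
  have hP : P.det = c := by
    simp [P, Matrix.det_diagonal, Finset.prod_update_of_mem]
  let ψ : L →ₗ[K] K := b.coord l ∘ₗ LinearMap.mulLeft K μ
  let G : Matrix (Fin n) (Fin n) K := Matrix.of fun i j => ψ (b i * b j)
  have hG : G.det = (-1) ^ (n * (n - 1) / 2) * Algebra.norm K μ := by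
    rw [Algebra.norm_eq_matrix_det b, ← det_gram_coord b hb hl, ← Matrix.det_mul,
      ← gram_mul_left]
    rfl
  have hG' := gram_mul_left b ψ θ
  refine ⟨P.transpose * G * P, P.transpose * (G * Algebra.leftMulMatrix b θ) * P, ?_, ?_, ?_⟩
  · have : G.transpose = G := by ext i j; simp [G, mul_comm]
    simp [Matrix.IsSymm, Matrix.transpose_mul, this, Matrix.mul_assoc]
  · have : (G * Algebra.leftMulMatrix b θ).transpose = G * Algebra.leftMulMatrix b θ := by
      rw [← hG']; ext i j; simp [mul_comm]
    rw [Matrix.IsSymm, Matrix.transpose_mul, Matrix.transpose_mul, this, Matrix.transpose_transpose,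
      Matrix.mul_assoc, Matrix.mul_assoc, Matrix.mul_assoc]
  · have hfac : (X : K[X]) • (P.transpose * G * P).map C -
        (P.transpose * (G * Algebra.leftMulMatrix b θ) * P).map C =
        P.transpose.map C * G.map C * (Algebra.leftMulMatrix b θ).charmatrix * P.map C := by
      simp only [Matrix.charmatrix, Matrix.map_mul, RingHom.mapMatrix_apply, Matrix.mul_sub,
        Matrix.sub_mul, Matrix.mul_assoc]
      congr 1
      rw [Matrix.scalar_apply, ← Matrix.smul_eq_diagonal_mul]
      simp
    have hC : ∀ M : Matrix (Fin n) (Fin n) K, (M.map C).det = C M.det := fun M =>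
      (RingHom.map_det C M).symm
    rw [hfac, Matrix.det_mul, Matrix.det_mul, Matrix.det_mul, hC, hC, hC, Matrix.det_transpose, hP,
      hG, ← Matrix.charpoly]
    have h1 : (C ((-1 : K) ^ (n * (n - 1) / 2))) * C ((-1) ^ (n * (n - 1) / 2)) = 1 := by
      rw [← C_mul, ← mul_pow]; simp
    simp only [C_mul, C_pow] at h1 ⊢
    linear_combination (C c ^ 2 * C (Algebra.norm K μ) * (Algebra.leftMulMatrix b θ).charpoly) * h1
theorem pencilDisc_eq_binForm_iff {K : Type*} [Field K] {n : ℕ} (A B : Matrix (Fin n) (Fin n) K)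
    (f : Fin (n + 1) → K) :
    pencilDisc A B = binForm f ↔
      C ((-1) ^ (n * (n - 1) / 2)) * ((X : K[X]) • A.map C - B.map C).det = fxOne f := by
  constructor
  · intro h
    have := congrArg (MvPolynomial.aeval ![(X : K[X]), 1]) h
    rw [pencilDisc, binForm, map_mul, AlgHom.map_det, map_sum] at this
    rw [fxOne, C_pow, C_neg, C_1]
    convert this using 2
    · simp
    · congr 1
      ext i j : 2
      simp
    · simp
  · intro h
    obtain ⟨F, _, ι, hι⟩ : ∃ (F : Type _) (_ : Field F) (ι : MvPolynomial (Fin 2) K →+* F),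
        Function.Injective ι :=
      ⟨FractionRing (MvPolynomial (Fin 2) K), inferInstance, algebraMap _ _,
        IsFractionRing.injective _ _⟩
    have hX1 : ι (MvPolynomial.X 1) ≠ 0 := by
      rw [Ne, map_eq_zero_iff _ hι]; exact MvPolynomial.X_ne_zero _
    let x := ι (MvPolynomial.X 0)
    let y := ι (MvPolynomial.X 1)
    let κ : K →+* F := ι.comp MvPolynomial.C
    have h1 := congrArg (fun z => y ^ n * eval₂RingHom κ (x / y) z) h
    apply hι
    rw [pencilDisc, binForm, map_mul, RingHom.map_det, map_sum]
    change y ^ n * eval₂RingHom κ (x / y) (_ * _) = y ^ n * eval₂RingHom κ (x / y) _ at h1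
    rw [fxOne, map_mul, RingHom.map_det, map_sum, mul_left_comm, Finset.mul_sum] at h1
    convert h1 using 1
    · congr 1
      · rw [coe_eval₂RingHom, eval₂_C]; simp
      · have hdet := Matrix.det_smul
          ((eval₂RingHom κ (x / y)).mapMatrix ((X : K[X]) • A.map C - B.map C)) y
        rw [Fintype.card_fin] at hdet
        rw [← hdet]
        congr 1
        ext i j
        simp [κ, mul_sub, x, y]
        field_simp
    · refine Finset.sum_congr rfl fun i _ => ?_
      have hp : y ^ n = y ^ (n - (i : ℕ)) * y ^ (i : ℕ) := by rw [← pow_add]; congr 1; omega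
      have hy : y ^ (n - (i : ℕ)) ≠ 0 := pow_ne_zero _ hX1
      simp only [map_mul, map_pow, coe_eval₂RingHom, eval₂_C, eval₂_X, hp, div_pow]
      change κ (f i) * x ^ (n - (i : ℕ)) * y ^ (i : ℕ) = _
      field_simp

theorem stmt0 {g : ℕ} (K : Type*) [Field K] (hchar : ringChar K ≠ 2)
    (n : ℕ) (hn : n = 2*g+2)
    (f : Fin (n+1) → K) (hf0 : f 0 ≠ 0)
    (hsep : (fxOne f).Separable) (hdeg : (fxOne f).natDegree = n) :
    (∃ A B : Matrix (Fin n) (Fin n) K, A.IsSymm ∧ B.IsSymm ∧ pencilDisc A B = binForm f)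
    ↔ ∃ (c : Kˣ) (μ : (Lf f)ˣ),
        f 0 = (c:K)^2 * Algebra.norm K (μ : Lf f) := by
  have hn0 : n ≠ 0 := by omega
  have hcoeff : (fxOne f).coeff n = f 0 := by
    rw [fxOne, finsetSum_coeff, Finset.sum_eq_single 0]
    · simp
    · intro i _ hi
      have : (i : ℕ) ≠ 0 := fun h => hi (Fin.ext h)
      rw [coeff_C_mul, coeff_X_pow, if_neg (by omega), mul_zero]
    · simp
  set q : K[X] := C (f 0)⁻¹ * fxOne f with hq
  have hqm : q.Monic := by
    rw [Monic, hq, leadingCoeff_mul, leadingCoeff_C, leadingCoeff, hdeg, hcoeff,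
      inv_mul_cancel₀ hf0]
  have hqf : fxOne f = C (f 0) * q := by
    rw [hq, ← mul_assoc, ← C_mul, mul_inv_cancel₀ hf0, C_1, one_mul]
  have hqd : q.natDegree = n := by rw [hq, natDegree_C_mul (inv_ne_zero hf0), hdeg]
  have hqs : q.Separable := by
    rw [hqf] at hsep; exact hsep.of_mul_right
  let pb := AdjoinRoot.powerBasis hqm.ne_zero
  have hmin : minpoly K pb.gen = q := AdjoinRoot.minpoly_powerBasis_gen_of_monic hqm
  let b := pb.basis.reindex (finCongr (show pb.dim = n from hqd))
  have hb : ∀ i, b i = pb.gen ^ (i : ℕ) := fun i => by simp [b]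
  constructor
  · rintro ⟨A, B, hA, hB, h⟩
    have hdetA : (-1) ^ (n * (n - 1) / 2) * A.det = f 0 := by
      have := congrArg (MvPolynomial.eval ![1, 0]) h
      rw [pencilDisc, binForm, map_mul, RingHom.map_det, map_sum, Finset.sum_eq_single 0] at this
      · convert this using 1
        · rw [Fintype.card_fin]
          congr 1
          · simp
          · congr 1; ext; simp
        · simp
      · intro i _ hi
        have : (i : ℕ) ≠ 0 := fun h => hi (Fin.ext h)
        simp [this]
      · simp
    have hA0 : A.det ≠ 0 := by
      intro h0; rw [h0, mul_zero] at hdetA; exact hf0 hdetA.symm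
    have hAu := isUnit_iff_ne_zero.2 hA0
    let T := A⁻¹ * B
    have hAT : A * T = B := Matrix.mul_nonsing_inv_cancel_left _ _ hAu
    have hT : T.charpoly = q := by
      have h1 := (pencilDisc_eq_binForm_iff A B f).1 h
      have h2 : (X : K[X]) • A.map C - B.map C = A.map C * T.charmatrix := by
        rw [Matrix.charmatrix, Matrix.mul_sub, RingHom.mapMatrix_apply, ← Matrix.map_mul, hAT,
          Matrix.scalar_apply, ← Matrix.smul_eq_mul_diagonal]
      rw [h2, Matrix.det_mul, ← Matrix.charpoly, ← RingHom.mapMatrix_apply, ← RingHom.map_det,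
        ← mul_assoc, ← C_mul, hdetA, hqf] at h1
      exact mul_left_cancel₀ (C_ne_zero.2 hf0) h1
    have hTA : T.transpose * A = A * T := by
      calc T.transpose * A = (A * T).transpose := by rw [Matrix.transpose_mul A T, hA.eq]
        _ = A * T := by rw [hAT, hB.eq]
    obtain ⟨v, hv⟩ := exists_cyclic_vector (T := T) (by rwa [hT])
    let ρ := pb.lift T (by rw [hmin, ← hT, Matrix.aeval_self_charpoly])
    have hρ : ∀ p : K[X], ρ (AdjoinRoot.mk q p) = aeval T p := fun p => by
      rw [← AdjoinRoot.aeval_eq]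
      exact pb.lift_aeval _ _ _
    suffices ∃ (c : Kˣ) (μ : (AdjoinRoot q)ˣ),
        (-1) ^ (n * (n - 1) / 2) * A.det = (c : K) ^ 2 * Algebra.norm K (μ : AdjoinRoot q) by
      obtain ⟨c, μ, h⟩ := this
      exact ⟨c, μ, hdetA.symm.trans h⟩
    refine exists_det_eq_sq_mul_norm b hb hn0 ρ (v := v) (fun x hx => ?_) hA0 fun x => ?_
    · obtain ⟨p, rfl⟩ := AdjoinRoot.mk_surjective x
      rw [hρ] at hx
      exact AdjoinRoot.mk_eq_zero.2 (hT ▸ hv p hx)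
    · obtain ⟨p, rfl⟩ := AdjoinRoot.mk_surjective x
      rw [hρ]
      induction p using Polynomial.induction_on' with
      | add p r hp hr => simp [Matrix.add_mul, Matrix.mul_add, hp, hr]
      | monomial k a =>
        have hk : (T ^ k).transpose * A = A * T ^ k := by
          induction k with
          | zero => simp
          | succ k ih =>
            rw [pow_succ, Matrix.transpose_mul, Matrix.mul_assoc, ih, ← Matrix.mul_assoc, hTA,
              Matrix.mul_assoc, ← pow_succ', pow_succ]
        rw [aeval_monomial, ← Algebra.smul_def, Matrix.transpose_smul, Matrix.smul_mul, hk,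
          Matrix.mul_smul]
  · rintro ⟨c, μ, h⟩
    obtain ⟨A, B, hA, hB, hAB⟩ := exists_pencil_of_sq_mul_norm b hb hn0 (c : K) (μ : Lf f)
    refine ⟨A, B, hA, hB, (pencilDisc_eq_binForm_iff A B f).2 ?_⟩
    have : FiniteDimensional K (AdjoinRoot q) := pb.finite
    have hchp : (Algebra.leftMulMatrix b pb.gen).charpoly = q := by
      rw [Algebra.leftMulMatrix_apply, LinearMap.charpoly_toMatrix,
        ← LinearMap.charpoly_toMatrix _ pb.basis, ← Algebra.leftMulMatrix_apply,
        charpoly_leftMulMatrix]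
      exact hmin
    rw [hAB, hchp]
    exact (congrArg (fun z => C z * q) h.symm).trans hqf.symm
end

section
/- Let K be a field of characteristic not 2, let g(x) ∈ K[x] be a monic separable polynomial of degree n, and let L = K[x]/(g(x)). Then there exists an element c ∈ L with c² = 1 and N_{L/K}(c) = −1 if and only if g(x) has a monic irreducible factor of odd degree in K[x]. -/
open Polynomial Matrix

theorem Algebra.norm_prod_apply {K A B : Type*} [Field K] [CommRing A] [CommRing B]
    [Algebra K A] [Algebra K B]
    [Module.Finite K A] [Module.Finite K B] (x : A × B) :
    Algebra.norm K x = Algebra.norm K x.1 * Algebra.norm K x.2 := by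
  have h : (Algebra.lmul K (A × B) x : A × B →ₗ[K] A × B) =
      (Algebra.lmul K A x.1 : A →ₗ[K] A).prodMap (Algebra.lmul K B x.2 : B →ₗ[K] B) := by
    ext <;> simp
  rw [Algebra.norm_apply, h, LinearMap.det_prodMap]
  rfl

theorem AdjoinRoot.finite_of_ne_zero {K : Type*} [Field K] {a : K[X]} (ha : a ≠ 0) :
    Module.Finite K (AdjoinRoot a) :=
  (AdjoinRoot.powerBasis ha).finite

theorem AdjoinRoot.norm_mk_mul {K : Type*} [Field K] {a b : K[X]} (ha : a ≠ 0) (hb : b ≠ 0)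
    (h : IsCoprime a b) (p : K[X]) :
    Algebra.norm K (AdjoinRoot.mk (a * b) p) =
      Algebra.norm K (AdjoinRoot.mk a p) * Algebra.norm K (AdjoinRoot.mk b p) := by
  have := AdjoinRoot.finite_of_ne_zero ha
  have := AdjoinRoot.finite_of_ne_zero hb
  let φ : AdjoinRoot (a * b) →ₐ[K] AdjoinRoot a × AdjoinRoot b :=
    (AdjoinRoot.algHomOfDvd K (a * b) a (dvd_mul_right a b)).prod
      (AdjoinRoot.algHomOfDvd K (a * b) b (dvd_mul_left b a))
  have hφ (r : K[X]) : φ (AdjoinRoot.mk (a * b) r) = (AdjoinRoot.mk a r, AdjoinRoot.mk b r) := by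
    rw [← AdjoinRoot.aeval_eq, AlgHom.prod_apply, ← aeval_algHom_apply, ← aeval_algHom_apply,
      AdjoinRoot.algHomOfDvd_root, AdjoinRoot.algHomOfDvd_root, AdjoinRoot.aeval_eq,
      AdjoinRoot.aeval_eq]
  have hbij : Function.Bijective φ := by
    constructor
    · rw [injective_iff_map_eq_zero]
      intro x hx
      obtain ⟨r, rfl⟩ := AdjoinRoot.mk_surjective x
      rw [hφ, Prod.mk_eq_zero, AdjoinRoot.mk_eq_zero, AdjoinRoot.mk_eq_zero] at hx
      exact AdjoinRoot.mk_eq_zero.2 (h.mul_dvd hx.1 hx.2)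
    · rintro ⟨x, y⟩
      obtain ⟨r, rfl⟩ := AdjoinRoot.mk_surjective x
      obtain ⟨s, rfl⟩ := AdjoinRoot.mk_surjective y
      obtain ⟨u, v, huv⟩ := h
      refine ⟨AdjoinRoot.mk _ (r * (v * b) + s * (u * a)), ?_⟩
      rw [hφ, Prod.mk.injEq, AdjoinRoot.mk_eq_mk, AdjoinRoot.mk_eq_mk]
      constructor
      · exact ⟨(s - r) * u, by linear_combination r * huv⟩
      · exact ⟨(r - s) * v, by linear_combination s * huv⟩
  rw [← Algebra.norm_eq_of_algEquiv (AlgEquiv.ofBijective φ hbij), AlgEquiv.ofBijective_apply, hφ,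
    Algebra.norm_prod_apply]

theorem AdjoinRoot.norm_mk_mul_of_dvd {K : Type*} [Field K] {a b : K[X]} (ha : a ≠ 0) (hb : b ≠ 0)
    (h : IsCoprime a b) {p : K[X]} (hpa : a ∣ p - 1) (hpb : b ∣ p + 1) :
    Algebra.norm K (AdjoinRoot.mk (a * b) p) = (-1) ^ b.natDegree := by
  have h1 : AdjoinRoot.mk a p = 1 := by
    rw [← map_one (AdjoinRoot.mk a), AdjoinRoot.mk_eq_mk]
    exact hpa
  have h2 : AdjoinRoot.mk b p = algebraMap K _ (-1) := by
    rw [map_neg, map_one, ← map_one (AdjoinRoot.mk b), ← map_neg, AdjoinRoot.mk_eq_mk]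
    simpa using hpb
  rw [AdjoinRoot.norm_mk_mul ha hb h, h1, h2, map_one, one_mul, Algebra.norm_algebraMap,
    (AdjoinRoot.powerBasis hb).finrank, AdjoinRoot.powerBasis_dim]

theorem Polynomial.exists_monic_irreducible_odd_natDegree {K : Type*} [Field K] {b : K[X]}
    (hb : Odd b.natDegree) : ∃ q : K[X], q.Monic ∧ Irreducible q ∧ q ∣ b ∧ Odd q.natDegree := by
  induction b using WfDvdMonoid.induction_on_irreducible with
  | zero => simp at hb
  | unit u hu => simp [natDegree_eq_zero_of_isUnit hu] at hb
  | mul a i ha hi ih =>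
    by_cases hodd : Odd i.natDegree
    · have hlc : i.leadingCoeff⁻¹ ≠ 0 := inv_ne_zero (leadingCoeff_ne_zero.2 hi.ne_zero)
      refine ⟨i * C i.leadingCoeff⁻¹, monic_mul_leadingCoeff_inv hi.ne_zero,
        irreducible_mul_leadingCoeff_inv.2 hi, ?_, ?_⟩
      · exact ((isUnit_C.2 hlc.isUnit).mul_right_dvd.2 dvd_rfl).trans (dvd_mul_right i a)
      · rwa [natDegree_mul_C hlc]
    · rw [natDegree_mul hi.ne_zero ha] at hb
      obtain ⟨q, hq, hqi, hqa, hqo⟩ := ih (by grind)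
      exact ⟨q, hq, hqi, hqa.mul_left i, hqo⟩

theorem stmt3 (K : Type*) [Field K] (hchar : ringChar K ≠ 2)
    (n : ℕ) (g : K[X]) (hmonic : g.Monic) (hdeg : g.natDegree = n) (hsep : g.Separable) :
    (∃ c : AdjoinRoot g, c ^ 2 = 1 ∧ Algebra.norm K c = -1) ↔
    (∃ q : K[X], q.Monic ∧ Irreducible q ∧ q ∣ g ∧ Odd q.natDegree) := by
  have h2 : (2 : K) ≠ 0 := Ring.two_ne_zero hchar
  constructor
  · rintro ⟨c, hc, hN⟩
    obtain ⟨p, rfl⟩ := AdjoinRoot.mk_surjective c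
    have hdvd : g ∣ (p - 1) * (p + 1) := by
      rw [← map_pow, ← map_one (AdjoinRoot.mk g), AdjoinRoot.mk_eq_mk] at hc
      convert hc using 1
      ring
    have hcop : IsCoprime (p - 1) (p + 1) := by
      have hC : (C 2⁻¹ : K[X]) * 2 = 1 := by
        rw [← C_ofNat, ← C_mul, inv_mul_cancel₀ h2, C_1]
      exact ⟨-C 2⁻¹, C 2⁻¹, by linear_combination hC⟩
    obtain ⟨a, b, hpa, hpb, rfl⟩ := exists_dvd_and_dvd_of_dvd_mul hdvd
    obtain ⟨ha, hb⟩ := mul_ne_zero_iff.1 hmonic.ne_zero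
    have hab := (hcop.of_isCoprime_of_dvd_left hpa).of_isCoprime_of_dvd_right hpb
    rw [AdjoinRoot.norm_mk_mul_of_dvd ha hb hab hpa hpb] at hN
    have hodd : Odd b.natDegree := by
      by_contra he
      rw [(Nat.not_odd_iff_even.1 he).neg_one_pow] at hN
      exact h2 (by linear_combination hN)
    obtain ⟨q, hq, hqi, hqb, hqo⟩ := Polynomial.exists_monic_irreducible_odd_natDegree hodd
    exact ⟨q, hq, hqi, hqb.mul_left a, hqo⟩
  · rintro ⟨q, hq, hqi, ⟨a, rfl⟩, hqo⟩
    rw [mul_comm q a] at *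
    obtain ⟨ha, -⟩ := mul_ne_zero_iff.1 hmonic.ne_zero
    have hcop := hsep.isCoprime
    obtain ⟨u, v, huv⟩ := hsep.isCoprime
    have hpa : a ∣ (1 - 2 * (u * a)) - 1 := ⟨-2 * u, by ring⟩
    have hpq : q ∣ (1 - 2 * (u * a)) + 1 := ⟨2 * v, by linear_combination -2 * huv⟩
    refine ⟨AdjoinRoot.mk _ (1 - 2 * (u * a)), ?_, ?_⟩
    · rw [← map_pow, ← map_one (AdjoinRoot.mk (a * q)), AdjoinRoot.mk_eq_mk]
      convert mul_dvd_mul hpa hpq using 1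
      ring
    · rw [AdjoinRoot.norm_mk_mul_of_dvd ha hq.ne_zero hcop hpa hpq, hqo.neg_one_pow]
end

section
/- Let K be a field of characteristic not 2, let n ≥ 4 be even, and let f(x,y) = f₀xⁿ + ⋯ + f_nyⁿ be a binary form of degree n over K with f₀ ≠ 0 and f(x,1) separable of degree n. Consider the set of SL_n(K)-orbits of pairs (A,B) of n×n symmetric matrices over K with invariant binary form f(x,y), and the set S = {α ∈ L^× : N_{L/K}(α) ∈ f₀·K^{×2}}/L^{×2}. If f(x,1) has a monic irreducible factor of odd degree in K[x], then the set of such orbits is in bijection with S; otherwise, there exists a surjective map from the set of such orbits onto S all of whose fibers have exactly 2 elements. -/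
open Polynomial Matrix

/-- The orbit relation for the action of `SL_n(K)` on pairs of symmetric matrices
with invariant binary form `f`. -/
def orbitRel {n : ℕ} (K : Type*) [Field K] (f : Fin (n+1) → K)
    (p q : {AB : Matrix (Fin n) (Fin n) K × Matrix (Fin n) (Fin n) K //
      AB.1.IsSymm ∧ AB.2.IsSymm ∧ pencilDisc AB.1 AB.2 = binForm f}) : Prop :=
  ∃ γ : Matrix.SpecialLinearGroup (Fin n) K,
    q.1.1 = (γ : Matrix (Fin n) (Fin n) K) * p.1.1 * (γ : Matrix (Fin n) (Fin n) K)ᵀ ∧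
    q.1.2 = (γ : Matrix (Fin n) (Fin n) K) * p.1.2 * (γ : Matrix (Fin n) (Fin n) K)ᵀ

/-- The relation on `{α ∈ L^× : N(α) ∈ f₀·K^{×2}}` identifying `α` with `u²·α`
for units `u ∈ L^×`; its quotient is `{α ∈ L^× : N(α) ∈ f₀·K^{×2}}/L^{×2}`. -/
def sqClassRel {n : ℕ} (K : Type*) [Field K] (f : Fin (n+1) → K)
    (a b : {α : Lf f // IsUnit α ∧ ∃ c : K, c ≠ 0 ∧ Algebra.norm K α = f 0 * c ^ 2}) : Prop :=
  ∃ u : Lf f, IsUnit u ∧ (b : Lf f) = u ^ 2 * (a : Lf f)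

theorem Fin.sign_revPerm (n : ℕ) :
    Equiv.Perm.sign (Fin.revPerm : Equiv.Perm (Fin n)) = (-1) ^ (n * (n - 1) / 2) := by
  rw [Equiv.Perm.sign_eq_prod_prod_Iio]
  have h : ∀ j : Fin n, ∏ i ∈ Finset.Iio j,
      (if (Fin.revPerm : Equiv.Perm (Fin n)) i < Fin.revPerm j then (1 : ℤˣ) else -1) =
      (-1) ^ (j : ℕ) := by
    intro j
    rw [Finset.prod_congr rfl (g := fun _ => (-1 : ℤˣ))]
    · simp
    · intro i hi
      rw [Finset.mem_Iio] at hi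
      simp [Fin.rev_lt_rev, hi.not_gt]
  rw [Finset.prod_congr rfl fun j _ => h j, Fin.prod_univ_eq_prod_range (fun i => (-1 : ℤˣ) ^ i) n,
    Finset.prod_pow_eq_pow_sum, Finset.sum_range_id]

/-- A matrix which vanishes above the antidiagonal and has ones on it. -/
theorem Matrix.det_of_antitriangular {n : ℕ} {R : Type*} [CommRing R] (M : Matrix (Fin n) (Fin n) R)
    (h0 : ∀ i j : Fin n, (i : ℕ) + j + 1 < n → M i j = 0)
    (h1 : ∀ i j : Fin n, (i : ℕ) + j + 1 = n → M i j = 1) :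
    M.det = (-1) ^ (n * (n - 1) / 2) := by
  have h := Matrix.det_permute (Fin.revPerm : Equiv.Perm (Fin n)) M
  have ht : (M.submatrix (Fin.revPerm : Equiv.Perm (Fin n)) id).det = 1 := by
    rw [Matrix.det_of_isUpperTriangular]
    · refine Finset.prod_eq_one fun i _ => h1 _ _ ?_
      simp only [Fin.revPerm_apply, Fin.val_rev, id]
      omega
    · intro i j hij
      refine h0 _ _ ?_
      have : (j : ℕ) < i := hij
      simp only [Fin.revPerm_apply, Fin.val_rev, id]
      omega
  rw [ht, Fin.sign_revPerm] at h
  push_cast at h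
  have hs : ((-1 : R) ^ (n * (n - 1) / 2)) * (-1) ^ (n * (n - 1) / 2) = 1 := by
    rw [← mul_pow]; simp
  calc M.det = ((-1 : R) ^ (n * (n - 1) / 2)) * (((-1) ^ (n * (n - 1) / 2)) * M.det) := by
        rw [← mul_assoc, hs, one_mul]
    _ = _ := by rw [← h, mul_one]

theorem Matrix.det_aeval_of_splits {n F : Type*} [Fintype n] [DecidableEq n] [Field F]
    (M : Matrix n n F) (hM : M.charpoly.Splits) (p : F[X]) (hp : p.Splits) :
    (aeval M p).det = (M.charpoly.roots.map fun r => p.eval r).prod := by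
  induction hp using Submonoid.closure_induction with
  | one => simp
  | mul p q _ _ hp hq => simp [hp, hq]
  | mem p hp =>
    have hcard : M.charpoly.roots.card = Fintype.card n := by
      rw [← hM.natDegree_eq_card_roots, Matrix.charpoly_natDegree_eq_dim]
    rcases hp with ⟨a, rfl⟩ | ⟨a, rfl⟩
    · simp [hcard, Matrix.algebraMap_eq_diagonal]
    · have h := Matrix.eval_charpoly M (-a)
      rw [hM.eval_eq_prod_roots_of_monic M.charpoly_monic] at h
      have e : aeval M (X + C a) = -(Matrix.scalar n (-a) - M) := by
        ext i j; simp [Matrix.algebraMap_eq_diagonal, Matrix.diagonal_apply]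
        split_ifs <;> ring
      rw [e, Matrix.det_neg, ← h, ← hcard, ← Multiset.card_map (fun r => -a - r),
        ← Multiset.prod_map_neg]
      simp [add_comm]

theorem Matrix.det_aeval_map {n K F : Type*} [Fintype n] [DecidableEq n] [Field K] [Field F]
    [IsAlgClosed F] [Algebra K F] (M : Matrix n n K) (p : K[X]) :
    algebraMap K F (aeval M p).det =
      ((M.charpoly.map (algebraMap K F)).roots.map fun r => aeval r p).prod := by
  have h := Matrix.det_aeval_of_splits (M.map (algebraMap K F)) (IsAlgClosed.splits _)
    (p.map (algebraMap K F)) (IsAlgClosed.splits _)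
  rw [Matrix.charpoly_map] at h
  simp only [Polynomial.aeval_def, ← Polynomial.eval_map]
  simp only [Polynomial.eval_map] at h ⊢
  rw [← h, RingHom.map_det]
  congr 1
  rw [Polynomial.aeval_map_algebraMap, ← Polynomial.aeval_def]
  exact (Polynomial.aeval_algHom_apply (Algebra.ofId K F).mapMatrix M p).symm

theorem Matrix.det_aeval_eq_neg_one_pow {n K : Type*} [Fintype n] [DecidableEq n] [Field K]
    (M : Matrix n n K) {d e p : K[X]} (hde : M.charpoly = d * e) (hd : d ∣ p + 1)
    (he : e ∣ p - 1) : (aeval M p).det = (-1) ^ d.natDegree := by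
  have hne : d * e ≠ 0 := hde ▸ M.charpoly_monic.ne_zero
  apply FaithfulSMul.algebraMap_injective K (AlgebraicClosure K)
  rw [Matrix.det_aeval_map, hde, Polynomial.map_mul, roots_mul, Multiset.map_add, Multiset.prod_add]
  · have h1 : ∀ r ∈ (d.map (algebraMap K (AlgebraicClosure K))).roots, aeval r p = -1 := by
      intro r hr
      have hr' : aeval r d = 0 := by
        have := isRoot_of_mem_roots hr
        rwa [IsRoot, eval_map_algebraMap] at this
      have := aeval_eq_zero_of_dvd_aeval_eq_zero hd hr'
      rw [map_add, map_one] at this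
      exact eq_neg_of_add_eq_zero_left this
    have h2 : ∀ r ∈ (e.map (algebraMap K (AlgebraicClosure K))).roots, aeval r p = 1 := by
      intro r hr
      have hr' : aeval r e = 0 := by
        have := isRoot_of_mem_roots hr
        rwa [IsRoot, eval_map_algebraMap] at this
      have := aeval_eq_zero_of_dvd_aeval_eq_zero he hr'
      rw [map_sub, map_one] at this
      exact sub_eq_zero.1 this
    rw [Multiset.map_congr rfl h1, Multiset.map_congr rfl h2]
    simp [← (IsAlgClosed.splits (d.map (algebraMap K (AlgebraicClosure K)))).natDegree_eq_card_roots]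
  · rw [← Polynomial.map_mul]
    exact Polynomial.map_ne_zero hne

theorem Matrix.exists_aeval_mulVec_eq_zero {n K : Type*} [Fintype n] [DecidableEq n] [Field K]
    (M : Matrix n n K) {q : K[X]} (hq : Irreducible q) (hqM : q ∣ M.charpoly) :
    ∃ w, w ≠ 0 ∧ aeval M q *ᵥ w = 0 := by
  rw [Matrix.exists_mulVec_eq_zero_iff]
  apply FaithfulSMul.algebraMap_injective K (AlgebraicClosure K)
  rw [Matrix.det_aeval_map, map_zero]
  obtain ⟨r, hr⟩ := IsAlgClosed.exists_aeval_eq_zero (AlgebraicClosure K) q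
    (degree_pos_of_irreducible hq).ne'
  refine Multiset.prod_eq_zero (Multiset.mem_map.2 ⟨r, ?_, hr⟩)
  rw [mem_roots (Polynomial.map_ne_zero M.charpoly_monic.ne_zero), IsRoot, eval_map_algebraMap]
  exact aeval_eq_zero_of_dvd_aeval_eq_zero hqM hr

/-- A matrix with squarefree characteristic polynomial has a cyclic vector. -/
theorem Matrix.exists_cyclic_vector {n K : Type*} [Fintype n] [DecidableEq n] [Field K]
    (M : Matrix n n K) (hM : Squarefree M.charpoly) :
    ∃ v : n → K, ∀ p : K[X], aeval M p *ᵥ v = 0 → M.charpoly ∣ p := by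
  have key : ∀ (k : ℕ) (v : n → K) (h c : K[X]), M.charpoly = h * c → c.natDegree ≤ k →
      (∀ p : K[X], aeval M p *ᵥ v = 0 ↔ h ∣ p) →
      ∃ v : n → K, ∀ p : K[X], aeval M p *ᵥ v = 0 → M.charpoly ∣ p := by
    intro k
    induction k with
    | zero =>
      intro v h c hc hk hv
      have hc0 : c ≠ 0 := by
        rintro rfl
        exact M.charpoly_monic.ne_zero (by simpa using hc)
      have hu : IsUnit c := by
        rw [isUnit_iff_degree_eq_zero, degree_eq_natDegree hc0, Nat.le_zero.1 hk]
        rfl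
      refine ⟨v, fun p hp => ?_⟩
      rw [hc, hu.mul_right_dvd]
      exact (hv p).1 hp
    | succ k ih =>
      intro v h c hc hk hv
      have hc0 : c ≠ 0 := by
        rintro rfl
        exact M.charpoly_monic.ne_zero (by simpa using hc)
      by_cases hu : IsUnit c
      · refine ⟨v, fun p hp => ?_⟩
        rw [hc, hu.mul_right_dvd]
        exact (hv p).1 hp
      obtain ⟨q, hq, c', rfl⟩ := WfDvdMonoid.exists_irreducible_factor hu hc0
      have hqh : ¬ q ∣ h := by
        rintro ⟨h', rfl⟩
        refine hq.not_isUnit (hM q ⟨h' * c', ?_⟩)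
        rw [hc]; ring
      obtain ⟨w, hw0, hw⟩ := M.exists_aeval_mulVec_eq_zero hq ⟨h * c', by rw [hc]; ring⟩
      have hqw : ∀ p : K[X], aeval M p *ᵥ w = 0 ↔ q ∣ p := by
        intro p
        constructor
        · intro hp
          by_contra hqp
          obtain ⟨a, b, hab⟩ := (hq.coprime_iff_not_dvd.2 hqp)
          apply hw0
          have := congrArg (fun s => aeval M s *ᵥ w) hab
          simpa [Matrix.add_mulVec, ← Matrix.mulVec_mulVec, hw, hp] using this.symm
        · rintro ⟨s, rfl⟩
          rw [mul_comm, map_mul, ← Matrix.mulVec_mulVec, hw, Matrix.mulVec_zero]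
      have hhv : aeval M h *ᵥ v = 0 := (hv h).2 dvd_rfl
      refine ih (v + w) (h * q) c' (by rw [hc]; ring) ?_ fun p => ⟨fun hp => ?_, ?_⟩
      · rw [natDegree_mul hq.ne_zero (right_ne_zero_of_mul hc0)] at hk
        have := hq.natDegree_pos
        omega
      · have h1 : aeval M (h * p) *ᵥ w = 0 := by
          have h2 : aeval M (h * p) *ᵥ (v + w) = 0 := by
            rw [map_mul, ← Matrix.mulVec_mulVec, hp, Matrix.mulVec_zero]
          have h3 : aeval M (h * p) *ᵥ v = 0 := (hv _).2 (dvd_mul_right _ _)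
          rwa [Matrix.mulVec_add, h3, zero_add] at h2
        have h4 : q ∣ p := (hq.prime.dvd_or_dvd ((hqw _).1 h1)).resolve_left hqh
        have h5 : h ∣ p := by
          rw [← hv]
          rwa [Matrix.mulVec_add, (hqw p).2 h4, add_zero] at hp
        exact ((hq.coprime_iff_not_dvd.2 hqh).symm).mul_dvd h5 h4
      · intro hp
        rw [Matrix.mulVec_add, (hv p).2 (dvd_of_mul_right_dvd hp),
          (hqw p).2 (dvd_of_mul_left_dvd hp), add_zero]
  exact key _ 0 1 M.charpoly (one_mul _).symm le_rfl (by simp)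

theorem det_of_pencilDisc_eq {n : ℕ} {K : Type*} [Field K] {A B : Matrix (Fin n) (Fin n) K}
    {f : Fin (n + 1) → K} (h : pencilDisc A B = binForm f) :
    (-1) ^ (n * (n - 1) / 2) * A.det = f 0 := by
  have h' := congrArg (MvPolynomial.eval ![1, 0]) h
  simp only [pencilDisc, binForm, map_mul, map_sum, map_pow, map_neg, map_one, RingHom.map_det,
    Fintype.card_fin, MvPolynomial.eval_C, MvPolynomial.eval_X] at h'
  rw [Fin.sum_univ_succ] at h'
  simp only [cons_val_zero, cons_val_one, Fin.val_succ, Fin.val_zero, one_pow, mul_one, pow_zero,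
    pow_succ, mul_zero, Finset.sum_const_zero, add_zero] at h'
  rw [← h']
  congr 2
  ext i j
  simp

theorem charpoly_of_pencilDisc_eq {n : ℕ} {K : Type*} [Field K] {A B : Matrix (Fin n) (Fin n) K}
    {f : Fin (n + 1) → K} (hf0 : f 0 ≠ 0) (h : pencilDisc A B = binForm f) :
    (A⁻¹ * B).charpoly = C (f 0)⁻¹ * fxOne f := by
  have hA := det_of_pencilDisc_eq h
  have hu : IsUnit A.det := by
    rw [isUnit_iff_ne_zero]
    rintro h0
    rw [h0, mul_zero] at hA
    exact hf0 hA.symm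
  have h' := congrArg (MvPolynomial.aeval (R := K) ![(X : K[X]), 1]) h
  simp only [pencilDisc, binForm, map_mul, map_sum, map_pow, map_neg, map_one, AlgHom.map_det,
    Fintype.card_fin, MvPolynomial.aeval_C, MvPolynomial.aeval_X] at h'
  have hR : (∑ x : Fin (n + 1), (algebraMap K K[X]) (f x) *
      ![(X : K[X]), 1] 0 ^ (n - (x : ℕ)) * ![(X : K[X]), 1] 1 ^ (x : ℕ)) = fxOne f := by
    simp [fxOne]
  rw [hR] at h'
  have hL : ((MvPolynomial.aeval (R := K) ![(X : K[X]), 1]).mapMatrix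
      (of fun i j => MvPolynomial.X 0 * MvPolynomial.C (A i j) -
        MvPolynomial.X 1 * MvPolynomial.C (B i j))) =
      A.map C * (A⁻¹ * B).charmatrix := by
    have : A.map (C : K →+* K[X]) * (A⁻¹ * B).map (C : K →+* K[X]) = B.map (C : K →+* K[X]) := by
      rw [← Matrix.map_mul, ← Matrix.mul_assoc, Matrix.mul_nonsing_inv _ hu, Matrix.one_mul]
    rw [Matrix.charmatrix, mul_sub]
    change _ = _ - A.map (C : K →+* K[X]) * (A⁻¹ * B).map (C : K →+* K[X])
    rw [this]
    ext i j
    simp only [AlgHom.mapMatrix_apply, map_apply, of_apply, map_sub, map_mul, MvPolynomial.aeval_X,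
      MvPolynomial.aeval_C, Matrix.sub_apply, scalar_apply, mul_diagonal, cons_val_zero,
      cons_val_one, one_mul]
    rw [mul_comm]
    rfl
  rw [hL, det_mul] at h'
  change _ * (_ * (A⁻¹ * B).charpoly) = _ at h'
  have hd : (A.map (C : K →+* K[X])).det = C A.det := ((C : K →+* K[X]).map_det A).symm
  rw [hd] at h'
  calc (A⁻¹ * B).charpoly = C ((f 0)⁻¹ * ((-1) ^ (n * (n - 1) / 2) * A.det)) *
        (A⁻¹ * B).charpoly := by rw [hA, inv_mul_cancel₀ hf0, C_1, one_mul]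
    _ = _ := by
      rw [← h']
      simp only [C_mul, C_pow, C_neg, C_1]
      ring

theorem pencilDisc_mul_eq {n : ℕ} {K : Type*} [Field K] {A M : Matrix (Fin n) (Fin n) K}
    {f : Fin (n + 1) → K} (hf0 : f 0 ≠ 0) (hA : (-1) ^ (n * (n - 1) / 2) * A.det = f 0)
    (hM : M.charpoly = C (f 0)⁻¹ * fxOne f) : pencilDisc A (A * M) = binForm f := by
  apply IsFractionRing.injective (MvPolynomial (Fin 2) K) (FractionRing (MvPolynomial (Fin 2) K))
  set F := FractionRing (MvPolynomial (Fin 2) K)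
  set ι := algebraMap (MvPolynomial (Fin 2) K) F with hι
  set κ : K →+* F := ι.comp MvPolynomial.C with hκ
  set x := ι (MvPolynomial.X 0)
  set y := ι (MvPolynomial.X 1)
  have hy : y ≠ 0 := by
    rw [ne_eq, IsFractionRing.to_map_eq_zero_iff]
    exact MvPolynomial.X_ne_zero _
  have hL : ι.mapMatrix (of fun i j => MvPolynomial.X 0 * MvPolynomial.C (A i j) -
        MvPolynomial.X 1 * MvPolynomial.C ((A * M) i j)) =
      A.map κ * (y • (Matrix.scalar (Fin n) (x / y) - M.map κ)) := by
    rw [smul_sub, mul_sub, mul_smul_comm, mul_smul_comm, ← Matrix.map_mul]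
    ext i j
    simp only [RingHom.mapMatrix_apply, map_apply, of_apply, map_sub, map_mul, Matrix.sub_apply,
      Matrix.smul_apply, smul_eq_mul, scalar_apply, mul_diagonal, hκ, RingHom.comp_apply]
    change x * _ - y * _ = _
    rw [mul_left_comm, mul_div_cancel₀ x hy, mul_comm x]
  rw [pencilDisc, binForm, map_mul, RingHom.map_det, hL, det_mul, det_smul, ← Matrix.eval_charpoly,
    Matrix.charpoly_map, hM, ← RingHom.mapMatrix_apply, ← RingHom.map_det]
  simp only [Fintype.card_fin, map_pow, map_neg, map_one, Polynomial.map_mul, eval_mul, map_C,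
    eval_C, map_inv₀, fxOne, Polynomial.map_sum, Polynomial.map_pow, map_X, eval_finsetSum,
    eval_pow, eval_X, map_sum, map_mul]
  have hA' : (-1) ^ (n * (n - 1) / 2) * κ A.det = κ (f 0) := by rw [← hA]; simp
  have h0 : κ (f 0) ≠ 0 := by simpa using hf0
  rw [← mul_assoc, hA']
  calc _ = y ^ n * ∑ i : Fin (n + 1), κ (f i) * (x / y) ^ (n - (i : ℕ)) := by field_simp
    _ = _ := by
      rw [Finset.mul_sum]
      refine Finset.sum_congr rfl fun i _ => ?_
      change _ = κ (f i) * x ^ (n - (i : ℕ)) * y ^ (i : ℕ)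
      have : y ^ n = y ^ (n - (i : ℕ)) * y ^ (i : ℕ) := by
        rw [← pow_add, Nat.sub_add_cancel (Nat.lt_succ_iff.1 i.2)]
      rw [this]
      generalize n - (i : ℕ) = k
      have hxy := mul_div_cancel₀ x hy
      generalize x / y = z at hxy ⊢
      rw [← hxy, mul_pow]
      ring

section RankOne

variable {K : Type*} [Field K] {g : K[X]} {n : ℕ}

/-- The power basis `1, θ, …, θ ^ (n - 1)` of `K[X] / (g)`, indexed by `Fin n`. -/
noncomputable def rootBasis (hg : g.Monic) (hn : g.natDegree = n) :
    Module.Basis (Fin n) K (AdjoinRoot g) :=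
  (AdjoinRoot.powerBasis' hg).basis.reindex (finCongr hn)

theorem rootBasis_apply (hg : g.Monic) (hn : g.natDegree = n) (i : Fin n) :
    rootBasis hg hn i = AdjoinRoot.root g ^ (i : ℕ) := by
  rw [rootBasis, Module.Basis.reindex_apply, PowerBasis.coe_basis]
  rfl

/-- Multiplication matrices with respect to the power basis. -/
noncomputable abbrev mulMat (hg : g.Monic) (hn : g.natDegree = n) :
    AdjoinRoot g →ₐ[K] Matrix (Fin n) (Fin n) K :=
  Algebra.leftMulMatrix (rootBasis hg hn)

/-- The linear functional picking the coefficient of `θ ^ (n - 1)`. -/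
noncomputable def topCoeff (hg : g.Monic) (n : ℕ) : AdjoinRoot g →ₗ[K] K :=
  lcoeff K (n - 1) ∘ₗ AdjoinRoot.modByMonicHom hg

/-- The Gram matrix of the bilinear form `(x, y) ↦ topCoeff (x * y * α)` in the power basis. -/
noncomputable def gramMat (hg : g.Monic) (hn : g.natDegree = n) (α : AdjoinRoot g) :
    Matrix (Fin n) (Fin n) K :=
  of fun i j => topCoeff hg n (rootBasis hg hn i * rootBasis hg hn j * α)

theorem gramMat_isSymm (hg : g.Monic) (hn : g.natDegree = n) (α : AdjoinRoot g) :
    (gramMat hg hn α).IsSymm := by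
  ext i j
  simp [gramMat, mul_comm (rootBasis hg hn i)]

theorem gramMat_mul (hg : g.Monic) (hn : g.natDegree = n) (α β : AdjoinRoot g) :
    gramMat hg hn (α * β) = gramMat hg hn α * mulMat hg hn β := by
  ext i j
  have h : β * rootBasis hg hn j = ∑ k, mulMat hg hn β k j • rootBasis hg hn k := by
    simp_rw [mulMat, Algebra.leftMulMatrix_eq_repr_mul]
    exact ((rootBasis hg hn).sum_repr _).symm
  rw [gramMat, of_apply, mul_assoc, mul_left_comm _ α β, mul_comm _ β, h, Finset.mul_sum,
    Finset.mul_sum, map_sum, Matrix.mul_apply]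
  refine Finset.sum_congr rfl fun k _ => ?_
  rw [mul_smul_comm, mul_smul_comm, map_smul, smul_eq_mul, gramMat, of_apply, mul_comm]
  congr 2
  ring

theorem mulMat_transpose_mul_gramMat_mul (hg : g.Monic) (hn : g.natDegree = n)
    (u α : AdjoinRoot g) :
    (mulMat hg hn u)ᵀ * gramMat hg hn α * mulMat hg hn u = gramMat hg hn (u ^ 2 * α) := by
  have h : (mulMat hg hn u)ᵀ * gramMat hg hn α = gramMat hg hn (α * u) := by
    rw [← gramMat_isSymm hg hn (α * u), gramMat_mul, transpose_mul, gramMat_isSymm hg hn α]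
  rw [h, ← gramMat_mul]
  congr 1
  ring

theorem det_gramMat_one (hg : g.Monic) (hn : g.natDegree = n) :
    (gramMat hg hn 1).det = (-1) ^ (n * (n - 1) / 2) := by
  have hX : ∀ k, k < n → AdjoinRoot.modByMonicHom hg (AdjoinRoot.root g ^ k) = X ^ k := by
    intro k hk
    rw [← AdjoinRoot.mk_X, ← map_pow, AdjoinRoot.modByMonicHom_mk, modByMonic_eq_self_iff hg,
      degree_X_pow, degree_eq_natDegree hg.ne_zero, hn]
    exact_mod_cast hk
  have key : ∀ i j : Fin n, (i : ℕ) + j < n →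
      gramMat hg hn 1 i j = if (i : ℕ) + j + 1 = n then 1 else 0 := by
    intro i j hij
    rw [gramMat, of_apply, mul_one, rootBasis_apply, rootBasis_apply, ← pow_add, topCoeff,
      LinearMap.comp_apply, hX _ hij, lcoeff_apply, coeff_X_pow]
    congr 1
    rw [eq_iff_iff]
    omega
  refine Matrix.det_of_antitriangular _ (fun i j hij => ?_) fun i j hij => ?_
  · rw [key _ _ (by omega), if_neg (by omega)]
  · rw [key _ _ (by omega), if_pos hij]

theorem det_mulMat (hg : g.Monic) (hn : g.natDegree = n) (α : AdjoinRoot g) :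
    (mulMat hg hn α).det = Algebra.norm K α :=
  (Algebra.norm_eq_matrix_det _ _).symm

theorem det_gramMat (hg : g.Monic) (hn : g.natDegree = n) (α : AdjoinRoot g) :
    (gramMat hg hn α).det = (-1) ^ (n * (n - 1) / 2) * Algebra.norm K α := by
  rw [← one_mul α, gramMat_mul, det_mul, det_gramMat_one, det_mulMat, one_mul]

theorem charpoly_mulMat_root (hg : g.Monic) (hn : g.natDegree = n) :
    (mulMat hg hn (AdjoinRoot.root g)).charpoly = g := by
  have h := charpoly_leftMulMatrix (AdjoinRoot.powerBasis' hg)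
  rw [AdjoinRoot.powerBasis'_gen, AdjoinRoot.minpoly_root hg.ne_zero, hg.leadingCoeff, inv_one, C_1,
    mul_one] at h
  refine Eq.trans ?_ ((Matrix.charpoly_reindex (finCongr hn) _).trans h)
  congr 1
  ext i j
  simp only [mulMat, Algebra.leftMulMatrix_eq_repr_mul, rootBasis, Module.Basis.reindex_apply,
    Module.Basis.repr_reindex_apply]
  exact (Algebra.leftMulMatrix_eq_repr_mul (AdjoinRoot.powerBasis' hg).basis _ _ _).symm

theorem aeval_mulMat_root (hg : g.Monic) (hn : g.natDegree = n) (p : K[X]) :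
    aeval (mulMat hg hn (AdjoinRoot.root g)) p = mulMat hg hn (AdjoinRoot.mk g p) := by
  rw [aeval_algHom_apply, AdjoinRoot.aeval_eq]

theorem exists_eq_mulMat (hg : g.Monic) (hn : g.natDegree = n) (Y : Matrix (Fin n) (Fin n) K)
    (h : Y * mulMat hg hn (AdjoinRoot.root g) = mulMat hg hn (AdjoinRoot.root g) * Y) :
    ∃ u, Y = mulMat hg hn u := by
  have hcomm : ∀ x, Y * mulMat hg hn x = mulMat hg hn x * Y := by
    intro x
    obtain ⟨p, rfl⟩ := AdjoinRoot.mk_surjective x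
    rw [← aeval_mulMat_root]
    have : Commute Y (aeval (mulMat hg hn (AdjoinRoot.root g)) p) := by
      induction p using Polynomial.induction_on' with
      | add p q hp hq => rw [map_add]; exact hp.add_right hq
      | monomial k a =>
        rw [aeval_monomial]
        exact (Algebra.commute_algebraMap_right a Y).mul_right (Commute.pow_right h k)
    exact this
  set b := rootBasis hg hn with hb
  refine ⟨Matrix.toLin b b Y 1, ?_⟩
  have hrepr : ∀ x, b.repr (Matrix.toLin b b Y x) = Y *ᵥ b.repr x := by
    intro x
    rw [← LinearMap.toMatrix_mulVec_repr b b, LinearMap.toMatrix_toLin]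
  ext i j
  rw [mulMat, Algebra.leftMulMatrix_eq_repr_mul, ← hb]
  have h1 : b.repr (Matrix.toLin b b Y 1 * b j) = Y *ᵥ b.repr (b j) := by
    rw [mul_comm, ← Algebra.leftMulMatrix_mulVec_repr, hrepr, Matrix.mulVec_mulVec, ← hcomm,
      ← Matrix.mulVec_mulVec, Algebra.leftMulMatrix_mulVec_repr, mul_one]
  rw [h1]
  simp [Finsupp.single_eq_pi_single]

theorem isUnit_of_norm_ne_zero_s3 (hg : g.Monic) (hn : g.natDegree = n) {α : AdjoinRoot g}
    (h : Algebra.norm K α ≠ 0) : IsUnit α := by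
  have hu : IsUnit (mulMat hg hn α).det := by
    rw [det_mulMat]; exact h.isUnit
  have h1 := Matrix.mul_nonsing_inv _ hu
  have h2 := Matrix.nonsing_inv_mul _ hu
  have hc : mulMat hg hn α * mulMat hg hn (AdjoinRoot.root g) =
      mulMat hg hn (AdjoinRoot.root g) * mulMat hg hn α := by
    rw [← map_mul, ← map_mul, mul_comm]
  obtain ⟨β, hβ⟩ := exists_eq_mulMat hg hn (mulMat hg hn α)⁻¹ <| by
    calc _ = (mulMat hg hn α)⁻¹ * (mulMat hg hn (AdjoinRoot.root g) * mulMat hg hn α) *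
          (mulMat hg hn α)⁻¹ := by
          rw [Matrix.mul_assoc, Matrix.mul_assoc, h1, Matrix.mul_one]
      _ = _ := by rw [← hc, ← Matrix.mul_assoc, h2, Matrix.one_mul]
  refine IsUnit.of_mul_eq_one β (Algebra.leftMulMatrix_injective (rootBasis hg hn) ?_)
  rw [map_mul, map_one]
  change mulMat hg hn α * mulMat hg hn β = 1
  rw [← hβ, h1]

/-- `K[X] / (g)`-module isomorphisms between rank one forms are multiplications. -/
theorem eq_mulMat_of_conj (hg : g.Monic) (hn : g.natDegree = n) {α β : AdjoinRoot g}
    {R : Matrix (Fin n) (Fin n) K} (hβ : Algebra.norm K β ≠ 0)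
    (h1 : R * gramMat hg hn α * Rᵀ = gramMat hg hn β)
    (h2 : R * gramMat hg hn (α * AdjoinRoot.root g) * Rᵀ = gramMat hg hn (β * AdjoinRoot.root g)) :
    ∃ u, R = (mulMat hg hn u)ᵀ ∧ β = u ^ 2 * α := by
  have hdet : ∀ γ, Algebra.norm K γ ≠ 0 → IsUnit (gramMat hg hn γ).det := by
    intro γ hγ
    rw [det_gramMat]
    exact (mul_ne_zero (pow_ne_zero _ (neg_ne_zero.2 one_ne_zero)) hγ).isUnit
  have hβ' := hdet β hβ
  have hRα : IsUnit (R * gramMat hg hn α).det := by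
    rw [← h1, det_mul] at hβ'
    exact isUnit_of_mul_isUnit_left hβ'
  obtain ⟨u, hu⟩ := exists_eq_mulMat hg hn Rᵀ <| by
    apply (Matrix.mulVec_injective_iff_isUnit.1 ?_ : IsUnit (R * gramMat hg hn α)).mul_left_cancel
    · rw [← Matrix.mul_assoc, h1, ← gramMat_mul, ← h2, gramMat_mul]
      simp only [Matrix.mul_assoc]
    · exact Matrix.mulVec_injective_iff_isUnit.2 ((Matrix.isUnit_iff_isUnit_det _).2 hRα)
  have hR : R = (mulMat hg hn u)ᵀ := by rw [← hu, transpose_transpose]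
  refine ⟨u, hR, ?_⟩
  rw [hu, hR, mulMat_transpose_mul_gramMat_mul] at h1
  have hone : IsUnit (gramMat hg hn 1) := by
    rw [Matrix.isUnit_iff_isUnit_det]
    exact hdet 1 (by simp)
  rw [← one_mul (u ^ 2 * α), ← one_mul β, gramMat_mul, gramMat_mul] at h1
  exact (Algebra.leftMulMatrix_injective (rootBasis hg hn) (hone.mul_left_cancel h1)).symm

theorem exists_conj_gramMat (hg : g.Monic) (hn : g.natDegree = n) (hsq : Squarefree g)
    {A B : Matrix (Fin n) (Fin n) K} (hA : A.IsSymm) (hB : B.IsSymm) (hu : IsUnit A.det)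
    (hT : (A⁻¹ * B).charpoly = g) :
    ∃ (P : Matrix (Fin n) (Fin n) K) (α : AdjoinRoot g), IsUnit P.det ∧
      A = P * gramMat hg hn α * Pᵀ ∧ B = P * gramMat hg hn (α * AdjoinRoot.root g) * Pᵀ := by
  set T := A⁻¹ * B with hTdef
  set θ := AdjoinRoot.root g
  set Cθ := mulMat hg hn θ with hCθ
  obtain ⟨v, hv⟩ := T.exists_cyclic_vector (hT ▸ hsq)
  rw [hT] at hv
  let Q : Matrix (Fin n) (Fin n) K := of fun i j => (T ^ (j : ℕ) *ᵥ v) i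
  have hQw : ∀ w : Fin n → K, Q *ᵥ w = aeval T (∑ j : Fin n, monomial (j : ℕ) (w j)) *ᵥ v := by
    intro w
    rw [map_sum, Matrix.sum_mulVec]
    ext i
    simp only [Q, mulVec, dotProduct, of_apply, Finset.sum_apply, aeval_monomial]
    refine Finset.sum_congr rfl fun j _ => ?_
    simp only [Algebra.algebraMap_eq_smul_one, smul_mul_assoc, one_mul, Matrix.smul_apply, smul_eq_mul,
      Finset.sum_mul]
    exact Finset.sum_congr rfl fun k _ => by ring
  have hQ : IsUnit Q.det := by
    rw [← Matrix.isUnit_iff_isUnit_det, ← Matrix.mulVec_injective_iff_isUnit]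
    refine (injective_iff_map_eq_zero (Matrix.mulVecLin Q)).2 fun w hw => ?_
    rw [Matrix.mulVecLin_apply, hQw] at hw
    have h0 := eq_zero_of_dvd_of_degree_lt (hv _ hw) <| by
      rw [degree_eq_natDegree hg.ne_zero, hn]
      simp_rw [← C_mul_X_pow_eq_monomial]
      exact degree_sum_fin_lt _
    ext j
    have := congrArg (fun p => coeff p (j : ℕ)) h0
    simpa [coeff_monomial, Fin.val_inj] using this
  have hTQ : T * Q = Q * Cθ := by
    have hcol : ∀ j, T *ᵥ (fun i => Q i j) = Q *ᵥ fun k => Cθ k j := by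
      intro j
      rw [hQw]
      have h1 : T *ᵥ (fun i => Q i j) = aeval T (X ^ ((j : ℕ) + 1) : K[X]) *ᵥ v := by
        rw [map_pow, aeval_X, pow_succ', ← Matrix.mulVec_mulVec v T]
        rfl
      rw [h1, ← sub_eq_zero, ← Matrix.sub_mulVec, ← map_sub]
      have hd : g ∣ X ^ ((j : ℕ) + 1) - ∑ k : Fin n, monomial (k : ℕ) (Cθ k j) := by
        rw [← AdjoinRoot.mk_eq_zero, map_sub, sub_eq_zero, map_pow, AdjoinRoot.mk_X, pow_succ',
          ← rootBasis_apply hg hn, ← (rootBasis hg hn).sum_repr (_ * _), map_sum]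
        refine Finset.sum_congr rfl fun k _ => ?_
        rw [hCθ, mulMat, Algebra.leftMulMatrix_eq_repr_mul, rootBasis_apply hg hn j, rootBasis_apply hg hn k,
          ← C_mul_X_pow_eq_monomial, (AdjoinRoot.mk g).map_mul, (AdjoinRoot.mk g).map_pow,
          AdjoinRoot.mk_X, AdjoinRoot.mk_C,
          Algebra.smul_def]
        rfl
      obtain ⟨s, hs⟩ := hd
      rw [hs, map_mul, ← hT, Matrix.aeval_self_charpoly, zero_mul, Matrix.zero_mulVec]
    ext i j
    exact congrFun (hcol j) i
  have hAT : A * T = B := by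
    rw [hTdef, ← Matrix.mul_assoc, Matrix.mul_nonsing_inv _ hu, Matrix.one_mul]
  set A' := Qᵀ * A * Q with hA'
  have hA's : A'ᵀ = A' := by
    rw [hA', transpose_mul, transpose_mul, transpose_transpose, hA, Matrix.mul_assoc]
  have hB' : A' * Cθ = Qᵀ * B * Q := by
    rw [hA', Matrix.mul_assoc, ← hTQ, ← Matrix.mul_assoc, Matrix.mul_assoc Qᵀ A T, hAT]
  have hAC : A' * Cθ = Cθᵀ * A' := by
    rw [← hA's, ← transpose_mul, hA's, hB', transpose_mul, transpose_mul, transpose_transpose, hB,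
      Matrix.mul_assoc]
  have hH : gramMat hg hn 1 * Cθ = Cθᵀ * gramMat hg hn 1 := by
    rw [← gramMat_isSymm hg hn 1, ← transpose_mul, gramMat_isSymm hg hn 1, ← gramMat_mul,
      gramMat_isSymm]
  have hH1 : IsUnit (gramMat hg hn 1) := by
    rw [Matrix.isUnit_iff_isUnit_det, det_gramMat_one]
    exact isUnit_one.neg.pow _
  have hH1d := (Matrix.isUnit_iff_isUnit_det _).1 hH1
  obtain ⟨α, hα⟩ := exists_eq_mulMat hg hn ((gramMat hg hn 1)⁻¹ * A') <| by
    apply hH1.mul_left_cancel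
    rw [← Matrix.mul_assoc, ← Matrix.mul_assoc, Matrix.mul_nonsing_inv _ hH1d, Matrix.one_mul,
      ← Matrix.mul_assoc, ← hCθ, hH, Matrix.mul_assoc Cθᵀ, ← Matrix.mul_assoc _ _ A',
      Matrix.mul_nonsing_inv _ hH1d, Matrix.one_mul, hAC]
  have hA'α : A' = gramMat hg hn α := by
    rw [← one_mul α, gramMat_mul, ← hα, ← Matrix.mul_assoc, Matrix.mul_nonsing_inv _ hH1d,
      Matrix.one_mul]
  have hinv : ∀ S : Matrix (Fin n) (Fin n) K, Q⁻¹ᵀ * (Qᵀ * S * Q) * Q⁻¹ᵀᵀ = S := by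
    intro S
    rw [transpose_transpose, Matrix.mul_assoc, Matrix.mul_assoc, Matrix.mul_nonsing_inv _ hQ,
      Matrix.mul_one, ← Matrix.mul_assoc, ← transpose_mul, Matrix.mul_nonsing_inv _ hQ,
      transpose_one, Matrix.one_mul]
  refine ⟨Q⁻¹ᵀ, α, ?_, ?_, ?_⟩
  · rw [det_transpose]
    exact (Matrix.isUnit_nonsing_inv_det _ hQ)
  · rw [← hA'α, hinv]
  · rw [gramMat_mul, ← hA'α, ← hCθ, hB', hinv]

end RankOne

section SquareRootsOfOne

variable {K : Type*} [Field K] {g : K[X]}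

theorem norm_mk_eq_neg_one_pow (hg : g.Monic) {d e p : K[X]} (hde : g = d * e) (hd : d ∣ p + 1)
    (he : e ∣ p - 1) : Algebra.norm K (AdjoinRoot.mk g p) = (-1) ^ d.natDegree := by
  rw [← det_mulMat hg rfl, ← aeval_mulMat_root]
  exact Matrix.det_aeval_eq_neg_one_pow _ ((charpoly_mulMat_root hg rfl).trans hde) hd he

theorem exists_sq_eq_one_and_norm_eq_neg_one (hg : g.Monic) (hsq : Squarefree g) {q : K[X]}
    (hq : Irreducible q) (hqg : q ∣ g) (hodd : Odd q.natDegree) :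
    ∃ u : AdjoinRoot g, u ^ 2 = 1 ∧ Algebra.norm K u = -1 := by
  obtain ⟨h, hh⟩ := hqg
  have hqh : ¬ q ∣ h := by
    rintro ⟨h', rfl⟩
    exact hq.not_isUnit (hsq q ⟨h', by rw [hh]; ring⟩)
  obtain ⟨a, b, hab⟩ := hq.coprime_iff_not_dvd.2 hqh
  refine ⟨AdjoinRoot.mk g (a * q - b * h), ?_, ?_⟩
  · rw [← sub_eq_zero, ← map_pow, ← map_one (AdjoinRoot.mk g), ← map_sub, AdjoinRoot.mk_eq_zero, hh]
    exact ⟨-4 * a * b, by linear_combination (a * q + b * h + 1) * hab⟩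
  · rw [norm_mk_eq_neg_one_pow hg hh, hodd.neg_one_pow]
    · exact ⟨2 * a, by linear_combination -hab⟩
    · exact ⟨-2 * b, by linear_combination hab⟩

theorem Polynomial.even_natDegree_of_irreducible_factors {p : K[X]} (hp : p ≠ 0)
    (h : ∀ q : K[X], q.Monic → Irreducible q → q ∣ p → Even q.natDegree) : Even p.natDegree := by
  classical
  induction p using WfDvdMonoid.induction_on_irreducible with
  | zero => exact absurd rfl hp
  | unit u hu => rw [natDegree_eq_zero_of_isUnit hu]; exact Even.zero
  | mul a i ha hi ih =>
    rw [natDegree_mul hi.ne_zero ha]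
    refine Even.add ?_ (ih ha fun q hq hqi hqa => h q hq hqi (hqa.mul_left i))
    have hm := associated_normalize i
    rw [natDegree_eq_of_degree_eq (degree_eq_degree_of_associated hm)]
    refine h _ (monic_normalize hi.ne_zero) (hm.irreducible hi) ?_
    exact (hm.symm.dvd).trans (dvd_mul_right i a)

theorem norm_eq_one_of_sq_eq_one (hg : g.Monic)
    (h : ¬ ∃ q : K[X], q.Monic ∧ Irreducible q ∧ q ∣ g ∧ Odd q.natDegree)
    {u : AdjoinRoot g} (hu : u ^ 2 = 1) : Algebra.norm K u = 1 := by
  obtain ⟨p, rfl⟩ := AdjoinRoot.mk_surjective u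
  have hdvd : g ∣ (p + 1) * (p - 1) := by
    rw [← AdjoinRoot.mk_eq_zero]
    calc _ = AdjoinRoot.mk g p ^ 2 - 1 := by simp only [map_mul, map_add, map_sub, map_one]; ring
      _ = 0 := by rw [hu, sub_self]
  obtain ⟨d, e, hd, he, hde⟩ := exists_dvd_and_dvd_of_dvd_mul hdvd
  rw [norm_mk_eq_neg_one_pow hg hde hd he]
  refine Even.neg_one_pow (Polynomial.even_natDegree_of_irreducible_factors ?_ ?_)
  · rintro rfl
    exact hg.ne_zero (by rw [hde, zero_mul])
  · intro q hq hqi hqd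
    rw [← Nat.not_odd_iff_even]
    exact fun ho => h ⟨q, hq, hqi, hqd.trans (hde ▸ dvd_mul_right d e), ho⟩

end SquareRootsOfOne

section Orbits

variable {K : Type*} [Field K] {n : ℕ}

theorem orbitRel_equivalence (f : Fin (n + 1) → K) : Equivalence (orbitRel K f) where
  refl p := ⟨1, by simp, by simp⟩
  symm := by
    rintro p q ⟨γ, h1, h2⟩
    have h3 : ((γ⁻¹ : Matrix.SpecialLinearGroup (Fin n) K) : Matrix (Fin n) (Fin n) K) *
        (γ : Matrix (Fin n) (Fin n) K) = 1 := by
      rw [← Matrix.SpecialLinearGroup.coe_mul, inv_mul_cancel, Matrix.SpecialLinearGroup.coe_one]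
    have h4 : ∀ S, ((γ⁻¹ : Matrix.SpecialLinearGroup (Fin n) K) : Matrix (Fin n) (Fin n) K) *
        ((γ : Matrix (Fin n) (Fin n) K) * S * (γ : Matrix (Fin n) (Fin n) K)ᵀ) *
        ((γ⁻¹ : Matrix.SpecialLinearGroup (Fin n) K) : Matrix (Fin n) (Fin n) K)ᵀ = S := by
      intro S
      rw [← Matrix.mul_assoc, ← Matrix.mul_assoc, h3, Matrix.one_mul, Matrix.mul_assoc,
        ← Matrix.transpose_mul, h3, Matrix.transpose_one, Matrix.mul_one]
    exact ⟨γ⁻¹, by rw [h1, h4], by rw [h2, h4]⟩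
  trans := by
    rintro p q r ⟨γ, h1, h2⟩ ⟨δ, h3, h4⟩
    refine ⟨δ * γ, ?_, ?_⟩
    · rw [h3, h1, Matrix.SpecialLinearGroup.coe_mul, transpose_mul]
      simp only [Matrix.mul_assoc]
    · rw [h4, h2, Matrix.SpecialLinearGroup.coe_mul, transpose_mul]
      simp only [Matrix.mul_assoc]

theorem sqClassRel_equivalence (f : Fin (n + 1) → K) : Equivalence (sqClassRel K f) where
  refl a := ⟨1, isUnit_one, by simp⟩
  symm := by
    rintro a b ⟨u, ⟨v, rfl⟩, h⟩
    refine ⟨_, (v⁻¹).isUnit, ?_⟩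
    rw [h, ← mul_assoc, ← mul_pow, Units.inv_mul, one_pow, one_mul]
  trans := by
    rintro a b c ⟨u, hu, h1⟩ ⟨v, hv, h2⟩
    exact ⟨v * u, hv.mul hu, by rw [h2, h1]; ring⟩

variable {g : K[X]}

/-- The pair `(A, B)` is the pair of forms attached to `α`, written in the basis given by `P`. -/
def IsGramPair (hg : g.Monic) (hn : g.natDegree = n) (A B P : Matrix (Fin n) (Fin n) K)
    (α : AdjoinRoot g) : Prop :=
  A = P * gramMat hg hn α * Pᵀ ∧ B = P * gramMat hg hn (α * AdjoinRoot.root g) * Pᵀ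

namespace IsGramPair

variable {hg : g.Monic} {hn : g.natDegree = n} {A B A' B' P P' : Matrix (Fin n) (Fin n) K}
  {α α' : AdjoinRoot g}

theorem det_eq (h : IsGramPair hg hn A B P α) :
    (-1) ^ (n * (n - 1) / 2) * A.det = Algebra.norm K α * P.det ^ 2 := by
  have hs : ((-1 : K) ^ (n * (n - 1) / 2)) * (-1) ^ (n * (n - 1) / 2) = 1 := by
    rw [← mul_pow]; simp
  rw [h.1, det_mul, det_mul, det_transpose, det_gramMat]
  linear_combination (P.det ^ 2 * Algebra.norm K α) * hs

theorem of_eq_sq_mul {u : AdjoinRoot g} (h : IsGramPair hg hn A B P α) (hu : α = u ^ 2 * α') :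
    IsGramPair hg hn A B (P * (mulMat hg hn u)ᵀ) α' := by
  constructor
  · rw [h.1, hu, ← mulMat_transpose_mul_gramMat_mul, transpose_mul, transpose_transpose]
    simp only [Matrix.mul_assoc]
  · rw [h.2, hu, mul_assoc (u ^ 2), ← mulMat_transpose_mul_gramMat_mul, transpose_mul, transpose_transpose]
    simp only [Matrix.mul_assoc]

theorem exists_of_conj (h : IsGramPair hg hn A B P α) (h' : IsGramPair hg hn A' B' P' α')
    (hP' : IsUnit P'.det) (hα' : Algebra.norm K α' ≠ 0) {γ : Matrix (Fin n) (Fin n) K}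
    (hA : A' = γ * A * γᵀ) (hB : B' = γ * B * γᵀ) :
    ∃ u, P'⁻¹ * γ * P = (mulMat hg hn u)ᵀ ∧ α' = u ^ 2 * α := by
  have key : ∀ S S' : Matrix (Fin n) (Fin n) K, P' * S' * P'ᵀ = γ * (P * S * Pᵀ) * γᵀ →
      (P'⁻¹ * γ * P) * S * (P'⁻¹ * γ * P)ᵀ = S' := by
    intro S S' hS
    calc _ = P'⁻¹ * (γ * (P * S * Pᵀ) * γᵀ) * P'⁻¹ᵀ := by
          simp only [transpose_mul, Matrix.mul_assoc]
      _ = (P'⁻¹ * P') * S' * (P'⁻¹ * P')ᵀ := by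
          rw [← hS]; simp only [transpose_mul, Matrix.mul_assoc]
      _ = S' := by
          rw [Matrix.nonsing_inv_mul _ hP', transpose_one, Matrix.one_mul, Matrix.mul_one]
  refine eq_mulMat_of_conj hg hn hα' (key _ _ ?_) (key _ _ ?_)
  · rw [← h.1, ← h'.1, hA]
  · rw [← h.2, ← h'.2, hB]

theorem exists_specialLinearGroup (h : IsGramPair hg hn A B P α)
    (h' : IsGramPair hg hn A' B' P' α) (hP : IsUnit P.det) (hdet : P.det = P'.det) :
    ∃ γ : Matrix.SpecialLinearGroup (Fin n) K,
      A' = (γ : Matrix (Fin n) (Fin n) K) * A * (γ : Matrix (Fin n) (Fin n) K)ᵀ ∧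
      B' = (γ : Matrix (Fin n) (Fin n) K) * B * (γ : Matrix (Fin n) (Fin n) K)ᵀ := by
  have hγ : P' * P⁻¹ * P = P' := by
    rw [Matrix.mul_assoc, Matrix.nonsing_inv_mul _ hP, Matrix.mul_one]
  have key : ∀ S, (P' * P⁻¹) * (P * S * Pᵀ) * (P' * P⁻¹)ᵀ = P' * S * P'ᵀ := by
    intro S
    calc _ = (P' * P⁻¹ * P) * S * (P' * P⁻¹ * P)ᵀ := by
          simp only [transpose_mul, Matrix.mul_assoc]
      _ = _ := by rw [hγ]
  refine ⟨⟨P' * P⁻¹, ?_⟩, ?_, ?_⟩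
  · rw [det_mul, ← hdet, ← det_mul, Matrix.mul_nonsing_inv _ hP, det_one]
  · rw [h.1, h'.1]; exact (key _).symm
  · rw [h.2, h'.2]; exact (key _).symm

end IsGramPair

end Orbits

section Classification

variable {K : Type*} [Field K] {n : ℕ} {f : Fin (n + 1) → K}

theorem leadingCoeff_fxOne (hdeg : (fxOne f).natDegree = n) : (fxOne f).leadingCoeff = f 0 := by
  rw [leadingCoeff, hdeg, fxOne, finsetSum_coeff, Finset.sum_eq_single 0]
  · simp
  · intro i _ hi
    have hi' : (i : ℕ) ≠ 0 := fun h => hi (Fin.ext h)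
    rw [coeff_C_mul_X_pow, if_neg (by omega)]
  · simp

theorem monic_C_inv_mul_fxOne (hf0 : f 0 ≠ 0) (hdeg : (fxOne f).natDegree = n) :
    (C (f 0)⁻¹ * fxOne f).Monic := by
  rw [Monic, leadingCoeff_mul, leadingCoeff_C, leadingCoeff_fxOne hdeg, inv_mul_cancel₀ hf0]

theorem dvd_C_inv_mul_fxOne_iff (hf0 : f 0 ≠ 0) {q : K[X]} :
    q ∣ C (f 0)⁻¹ * fxOne f ↔ q ∣ fxOne f :=
  (isUnit_C.2 (inv_ne_zero hf0).isUnit).dvd_mul_left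

variable {hg : (C (f 0)⁻¹ * fxOne f).Monic} {hn : (C (f 0)⁻¹ * fxOne f).natDegree = n}
  {x x' : {AB : Matrix (Fin n) (Fin n) K × Matrix (Fin n) (Fin n) K //
    AB.1.IsSymm ∧ AB.2.IsSymm ∧ pencilDisc AB.1 AB.2 = binForm f}}
  {y y' : {α : Lf f // IsUnit α ∧ ∃ c : K, c ≠ 0 ∧ Algebra.norm K α = f 0 * c ^ 2}}
  {P P' : Matrix (Fin n) (Fin n) K}

theorem norm_ne_zero_of_sqClass (hf0 : f 0 ≠ 0) : Algebra.norm K y.1 ≠ 0 := by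
  obtain ⟨c, hc, h⟩ := y.2.2
  rw [h]
  exact mul_ne_zero hf0 (pow_ne_zero _ hc)

theorem IsGramPair.norm_mul_det_sq (h : IsGramPair hg hn x.1.1 x.1.2 P y.1) :
    Algebra.norm K y.1 * P.det ^ 2 = f 0 := by
  rw [← h.det_eq, det_of_pencilDisc_eq x.2.2.2]

theorem IsGramPair.isUnit_det (hf0 : f 0 ≠ 0) (h : IsGramPair hg hn x.1.1 x.1.2 P y.1) :
    IsUnit P.det := by
  rw [isUnit_iff_ne_zero]
  rintro h0
  apply hf0
  rw [← h.norm_mul_det_sq, h0]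
  ring

theorem exists_isGramPair_of_pair (hg : (C (f 0)⁻¹ * fxOne f).Monic)
    (hn : (C (f 0)⁻¹ * fxOne f).natDegree = n) (hf0 : f 0 ≠ 0)
    (hsq : Squarefree (C (f 0)⁻¹ * fxOne f))
    (x : {AB : Matrix (Fin n) (Fin n) K × Matrix (Fin n) (Fin n) K //
      AB.1.IsSymm ∧ AB.2.IsSymm ∧ pencilDisc AB.1 AB.2 = binForm f}) :
    ∃ y : {α : Lf f // IsUnit α ∧ ∃ c : K, c ≠ 0 ∧ Algebra.norm K α = f 0 * c ^ 2},
      ∃ P, IsGramPair hg hn x.1.1 x.1.2 P y.1 := by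
  have hdet := det_of_pencilDisc_eq x.2.2.2
  have hu : IsUnit x.1.1.det := by
    rw [isUnit_iff_ne_zero]
    intro h0
    rw [h0, mul_zero] at hdet
    exact hf0 hdet.symm
  obtain ⟨P, α, hP, hα⟩ := exists_conj_gramMat hg hn hsq x.2.1 x.2.2.1 hu
    (charpoly_of_pencilDisc_eq hf0 x.2.2.2)
  have hα' : IsGramPair hg hn x.1.1 x.1.2 P α := hα
  have hnorm := hα'.det_eq
  rw [hdet] at hnorm
  have hP0 := hP.ne_zero
  have hα0 : Algebra.norm K α = f 0 * (P.det⁻¹) ^ 2 := by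
    rw [eq_comm]
    exact (congrArg (· * (P.det⁻¹) ^ 2) hnorm).trans (by field_simp)
  have hne : Algebra.norm K α ≠ 0 := by
    rw [hα0]
    exact mul_ne_zero hf0 (pow_ne_zero _ (inv_ne_zero hP0))
  exact ⟨⟨α, isUnit_of_norm_ne_zero_s3 hg hn hne, P.det⁻¹, inv_ne_zero hP0, hα0⟩, P, hα⟩

theorem exists_isGramPair_of_det (hg : (C (f 0)⁻¹ * fxOne f).Monic)
    (hn : (C (f 0)⁻¹ * fxOne f).natDegree = n) (hf0 : f 0 ≠ 0) (hpos : 0 < n) {α : Lf f} {d : K}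
    (hd : Algebra.norm K α * d ^ 2 = f 0) :
    ∃ (x : {AB : Matrix (Fin n) (Fin n) K × Matrix (Fin n) (Fin n) K //
      AB.1.IsSymm ∧ AB.2.IsSymm ∧ pencilDisc AB.1 AB.2 = binForm f}) (P : _),
      P.det = d ∧ IsGramPair hg hn x.1.1 x.1.2 P α := by
  let P : Matrix (Fin n) (Fin n) K := diagonal (Function.update 1 ⟨0, hpos⟩ d)
  have hPd : P.det = d := by
    rw [det_diagonal, Finset.prod_update_of_mem (Finset.mem_univ _)]
    simp
  have hP : IsUnit P.det := by
    rw [hPd, isUnit_iff_ne_zero]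
    rintro rfl
    apply hf0
    rw [← hd]
    ring
  have hsymm : ∀ β, (P * gramMat hg hn β * Pᵀ).IsSymm := by
    intro β
    rw [IsSymm, transpose_mul, transpose_mul, transpose_transpose, gramMat_isSymm hg hn β,
      Matrix.mul_assoc]
  set θ := AdjoinRoot.root (C (f 0)⁻¹ * fxOne f)
  have hpair : IsGramPair hg hn (P * gramMat hg hn α * Pᵀ) (P * gramMat hg hn (α * θ) * Pᵀ) P α :=
    ⟨rfl, rfl⟩
  refine ⟨⟨(P * gramMat hg hn α * Pᵀ, P * gramMat hg hn (α * θ) * Pᵀ), hsymm _, hsymm _, ?_⟩, P,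
    hPd, hpair⟩
  have hPt : IsUnit Pᵀ.det := by rwa [det_transpose]
  have hB : P * gramMat hg hn (α * θ) * Pᵀ =
      P * gramMat hg hn α * Pᵀ * (Pᵀ⁻¹ * mulMat hg hn θ * Pᵀ) := by
    calc _ = P * gramMat hg hn α * (Pᵀ * Pᵀ⁻¹) * mulMat hg hn θ * Pᵀ := by
          rw [Matrix.mul_nonsing_inv _ hPt, Matrix.mul_one, gramMat_mul]
          simp only [Matrix.mul_assoc]
      _ = _ := by simp only [Matrix.mul_assoc]
  change pencilDisc (P * gramMat hg hn α * Pᵀ) (P * gramMat hg hn (α * θ) * Pᵀ) = _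
  rw [hB]
  refine pencilDisc_mul_eq hf0 ?_ ?_
  · rw [hpair.det_eq, hPd, hd]
  · have hc := charpoly_mulMat_root hg hn
    have hPu : IsUnit Pᵀ := (Matrix.isUnit_iff_isUnit_det _).2 hPt
    obtain ⟨U, hU⟩ := hPu
    rw [← hU, Matrix.charpoly_units_conj']
    exact hc

theorem sqClassRel_of_orbitRel (hf0 : f 0 ≠ 0) (h : IsGramPair hg hn x.1.1 x.1.2 P y.1)
    (h' : IsGramPair hg hn x'.1.1 x'.1.2 P' y'.1) (hx : orbitRel K f x x') :
    sqClassRel K f y y' := by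
  obtain ⟨γ, hA, hB⟩ := hx
  obtain ⟨u, -, hu⟩ := h.exists_of_conj h' (h'.isUnit_det hf0) (norm_ne_zero_of_sqClass hf0) hA hB
  refine ⟨u, ?_, hu⟩
  have := y'.2.1
  rw [hu] at this
  exact (isUnit_pow_iff two_ne_zero).1 (isUnit_of_mul_isUnit_left this)

theorem IsGramPair.exists_of_sqClassRel (h : IsGramPair hg hn x.1.1 x.1.2 P y.1)
    (hy : sqClassRel K f y y') : ∃ P', IsGramPair hg hn x.1.1 x.1.2 P' y'.1 := by
  obtain ⟨u, -, hu⟩ := (sqClassRel_equivalence f).symm hy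
  exact ⟨_, h.of_eq_sq_mul hu⟩

theorem orbitRel_of_det_eq (hf0 : f 0 ≠ 0) (h : IsGramPair hg hn x.1.1 x.1.2 P y.1)
    (h' : IsGramPair hg hn x'.1.1 x'.1.2 P' y.1) (hdet : P.det = P'.det) : orbitRel K f x x' :=
  h.exists_specialLinearGroup h' (h.isUnit_det hf0) hdet

theorem IsGramPair.det_eq_or_eq_neg {d : K} (hf0 : f 0 ≠ 0)
    (h : IsGramPair hg hn x.1.1 x.1.2 P y.1) (hd : Algebra.norm K y.1 * d ^ 2 = f 0) :
    P.det = d ∨ P.det = -d := by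
  rw [← sq_eq_sq_iff_eq_or_eq_neg]
  exact mul_left_cancel₀ (norm_ne_zero_of_sqClass hf0) (h.norm_mul_det_sq.trans hd.symm)

theorem orbitRel_of_exists_norm_eq_neg_one (hf0 : f 0 ≠ 0)
    (hu : ∃ u : Lf f, u ^ 2 = 1 ∧ Algebra.norm K u = -1)
    (h : IsGramPair hg hn x.1.1 x.1.2 P y.1) (h' : IsGramPair hg hn x'.1.1 x'.1.2 P' y.1) :
    orbitRel K f x x' := by
  obtain ⟨u, hu, hun⟩ := hu
  rcases h.det_eq_or_eq_neg hf0 h'.norm_mul_det_sq with hd | hd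
  · exact orbitRel_of_det_eq hf0 h h' hd
  · refine orbitRel_of_det_eq hf0 h (h'.of_eq_sq_mul (u := u) (by rw [hu, one_mul])) ?_
    rw [hd, det_mul, det_transpose, det_mulMat, hun, mul_neg_one]

theorem det_eq_of_orbitRel (hf0 : f 0 ≠ 0)
    (hu : ∀ u : Lf f, u ^ 2 = 1 → Algebra.norm K u = 1)
    (h : IsGramPair hg hn x.1.1 x.1.2 P y.1) (h' : IsGramPair hg hn x'.1.1 x'.1.2 P' y.1)
    (hx : orbitRel K f x x') : P.det = P'.det := by
  obtain ⟨γ, hA, hB⟩ := hx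
  have hP' := h'.isUnit_det hf0
  obtain ⟨u, hγ, hy⟩ := h.exists_of_conj h' hP' (norm_ne_zero_of_sqClass hf0) hA hB
  have hu1 : u ^ 2 = 1 := by
    apply y.2.1.mul_right_cancel
    rw [← hy, one_mul]
  have hdet := congrArg det hγ
  rw [det_transpose, det_mulMat, hu u hu1, det_mul, det_mul, Matrix.SpecialLinearGroup.det_coe,
    mul_one, det_nonsing_inv, Ring.inverse_eq_inv'] at hdet
  exact (eq_of_inv_mul_eq_one hdet).symm

end Classification

theorem stmt4 (K : Type*) [Field K] (hchar : ringChar K ≠ 2) (n : ℕ) (hn : 4 ≤ n) (hneven : Even n)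
    (f : Fin (n+1) → K) (hf0 : f 0 ≠ 0)
    (hsep : (fxOne f).Separable) (hdeg : (fxOne f).natDegree = n) :
    ((∃ q : K[X], q.Monic ∧ Irreducible q ∧ q ∣ fxOne f ∧ Odd q.natDegree) →
      Nonempty (Quot (orbitRel K f) ≃ Quot (sqClassRel K f))) ∧
    (¬ (∃ q : K[X], q.Monic ∧ Irreducible q ∧ q ∣ fxOne f ∧ Odd q.natDegree) →
      ∃ φ : Quot (orbitRel K f) → Quot (sqClassRel K f),
        Function.Surjective φ ∧ ∀ s, Nat.card {o : Quot (orbitRel K f) // φ o = s} = 2) := by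
  have hg := monic_C_inv_mul_fxOne hf0 hdeg
  have hgn : (C (f 0)⁻¹ * fxOne f).natDegree = n := by
    rw [natDegree_C_mul (inv_ne_zero hf0), hdeg]
  have hsq : Squarefree (C (f 0)⁻¹ * fxOne f) :=
    hsep.squarefree.squarefree_of_dvd ((dvd_C_inv_mul_fxOne_iff hf0).1 dvd_rfl)
  have hpos : 0 < n := by omega
  choose F hF using exists_isGramPair_of_pair hg hgn hf0 hsq
  let φ : Quot (orbitRel K f) → Quot (sqClassRel K f) :=
    Quot.lift (fun x => Quot.mk _ (F x)) fun x x' hx => by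
      obtain ⟨P, hP⟩ := hF x
      obtain ⟨P', hP'⟩ := hF x'
      exact Quot.sound (sqClassRel_of_orbitRel hf0 hP hP' hx)
  have hφ : ∀ x y, φ (Quot.mk _ x) = Quot.mk _ y ↔ ∃ P, IsGramPair hg hgn x.1.1 x.1.2 P y.1 := by
    intro x y
    obtain ⟨P, hP⟩ := hF x
    constructor
    · intro h
      exact hP.exists_of_sqClassRel ((sqClassRel_equivalence f).eqvGen_iff.1 (Quot.eqvGen_exact h))
    · rintro ⟨P', hP'⟩
      exact Quot.sound (sqClassRel_of_orbitRel hf0 hP hP' ((orbitRel_equivalence f).refl x))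
  have hdet : ∀ y : {α : Lf f // IsUnit α ∧ ∃ c : K, c ≠ 0 ∧ Algebra.norm K α = f 0 * c ^ 2},
      ∃ d : K, d ≠ 0 ∧ Algebra.norm K y.1 * d ^ 2 = f 0 := by
    intro y
    obtain ⟨c, hc, h⟩ := y.2.2
    exact ⟨c⁻¹, inv_ne_zero hc, by rw [h]; field_simp⟩
  have hsurj : Function.Surjective φ := by
    rintro ⟨y⟩
    obtain ⟨d, -, hd⟩ := hdet y
    obtain ⟨x, P, -, hP⟩ := exists_isGramPair_of_det hg hgn hf0 hpos hd
    exact ⟨Quot.mk _ x, (hφ x y).2 ⟨P, hP⟩⟩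
  refine ⟨?_, fun hodd => ⟨φ, hsurj, ?_⟩⟩
  · rintro ⟨q, -, hqi, hqf, hqo⟩
    have hu := exists_sq_eq_one_and_norm_eq_neg_one hg hsq hqi
      ((dvd_C_inv_mul_fxOne_iff hf0).2 hqf) hqo
    refine ⟨Equiv.ofBijective φ ⟨?_, hsurj⟩⟩
    rintro ⟨x⟩ ⟨x'⟩ h
    obtain ⟨P', hP'⟩ := hF x'
    obtain ⟨P, hP⟩ := (hφ x (F x')).1 (h.trans ((hφ x' (F x')).2 ⟨P', hP'⟩))
    exact Quot.sound (orbitRel_of_exists_norm_eq_neg_one hf0 hu hP hP')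
  · rintro ⟨y⟩
    have hu : ∀ u : Lf f, u ^ 2 = 1 → Algebra.norm K u = 1 := fun u hu =>
      norm_eq_one_of_sq_eq_one hg (by simpa only [dvd_C_inv_mul_fxOne_iff hf0] using hodd) hu
    obtain ⟨d, hd0, hd⟩ := hdet y
    obtain ⟨x, P, hPd, hP⟩ := exists_isGramPair_of_det hg hgn hf0 hpos hd
    obtain ⟨x', P', hPd', hP'⟩ := exists_isGramPair_of_det hg hgn hf0 hpos
      (show _ * (-d) ^ 2 = _ by rw [neg_sq, hd])
    rw [Nat.card_eq_two_iff]
    refine ⟨⟨Quot.mk _ x, (hφ x y).2 ⟨P, hP⟩⟩, ⟨Quot.mk _ x', (hφ x' y).2 ⟨P', hP'⟩⟩, ?_, ?_⟩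
    · intro h
      have hx := (orbitRel_equivalence f).eqvGen_iff.1 (Quot.eqvGen_exact (congrArg Subtype.val h))
      have := det_eq_of_orbitRel hf0 hu hP hP' hx
      rw [hPd, hPd'] at this
      exact hd0 ((Ring.eq_self_iff_eq_zero_of_char_ne_two hchar).1 this.symm)
    · rw [Set.eq_univ_iff_forall]
      rintro ⟨⟨z⟩, hz⟩
      obtain ⟨Q, hQ⟩ := (hφ z y).1 hz
      rcases hQ.det_eq_or_eq_neg hf0 hd with h | h
      · exact Or.inl (Subtype.ext (Quot.sound (orbitRel_of_det_eq hf0 hQ hP (h.trans hPd.symm))))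
      · exact Or.inr (Subtype.ext (Quot.sound (orbitRel_of_det_eq hf0 hQ hP' (h.trans hPd'.symm))))
end
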